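/- arXiv:2410.20390 — 6 statements merged into one kernel-verified Lean document; each statement's English description precedes it below -/
import Mathlib

section
/- Let K be a field of characteristic zero, R = K[x_0,...,x_n], S = K[y_0,...,y_n] acting on R by differentiation (y_i acts as ∂/∂x_i), and let F ∈ R be homogeneous of degree d. Then: (1) Ann(F) ⊆ Ann(J_F); (2) for every e with 0 ≤ e ≤ d-1, the degree-e graded pieces agree, Ann(F)_e = Ann(J_F)_e; and (3) Ann(J_F)_d = S_d, the full space of degree-d forms in S. -/
open MvPolynomial

/-- Apply the iterated partial-derivative operator `∏ i, (∂/∂xᵢ)^(d i)` to `F`. -/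
noncomputable def diffOp {K : Type*} [CommSemiring K] {m : ℕ} (d : Fin m →₀ ℕ)
    (F : MvPolynomial (Fin m) K) : MvPolynomial (Fin m) K :=
  (List.finRange m).foldr (fun i G => (⇑(MvPolynomial.pderiv i))^[d i] G) F

/-- Apolarity action: apply the differential polynomial `δ` (in the dual variables)
to the polynomial `F`. -/
noncomputable def applyDiff {K : Type*} [CommSemiring K] {m : ℕ}
    (δ F : MvPolynomial (Fin m) K) : MvPolynomial (Fin m) K :=
  δ.support.sum fun d => δ.coeff d • diffOp d F

theorem pderiv_commute {K : Type*} [CommSemiring K] {σ : Type*} (i j : σ) :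
    Function.Commute (pderiv (R := K) i) (pderiv (R := K) j) := by
  classical
  intro F
  induction F using MvPolynomial.induction_on with
  | C a => simp
  | add p q hp hq => simp only [map_add, hp, hq]
  | mul_X p k h =>
    simp only [Derivation.leibniz, pderiv_X, map_add, smul_eq_mul, h, Pi.single_apply]
    split_ifs <;> simp <;> ring

theorem pderiv_diffOp {K : Type*} [CommSemiring K] {m : ℕ} (d : Fin m →₀ ℕ) (j : Fin m)
    (F : MvPolynomial (Fin m) K) : pderiv j (diffOp d F) = diffOp d (pderiv j F) := by
  unfold diffOp
  induction List.finRange m with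
  | nil => rfl
  | cons i l ih =>
    rw [List.foldr_cons, List.foldr_cons, ← ih]
    exact (pderiv_commute j i).iterate_right (d i) _

theorem pderiv_applyDiff {K : Type*} [CommSemiring K] {m : ℕ} (δ : MvPolynomial (Fin m) K)
    (j : Fin m) (F : MvPolynomial (Fin m) K) :
    pderiv j (applyDiff δ F) = applyDiff δ (pderiv j F) := by
  simp only [applyDiff, map_sum, Derivation.map_smul, pderiv_diffOp]

theorem isHomogeneous_iterate_pderiv {K : Type*} [CommSemiring K] {σ : Type*} (i : σ) (k : ℕ)
    {F : MvPolynomial σ K} {d : ℕ} (hF : F.IsHomogeneous d) :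
    ((pderiv i)^[k] F).IsHomogeneous (d - k) := by
  induction k with
  | zero => simpa using hF
  | succ k ih =>
    rw [Function.iterate_succ_apply', ← Nat.sub_sub]
    exact ih.pderiv

theorem isHomogeneous_diffOp {K : Type*} [CommSemiring K] {m : ℕ} (e : Fin m →₀ ℕ)
    {F : MvPolynomial (Fin m) K} {d : ℕ} (hF : F.IsHomogeneous d) :
    (diffOp e F).IsHomogeneous (d - e.degree) := by
  have h (l : List (Fin m)) :
      (l.foldr (fun i G => (⇑(pderiv i))^[e i] G) F).IsHomogeneous (d - (l.map e).sum) := by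
    induction l with
    | nil => simpa using hF
    | cons i l ih =>
      rw [List.foldr_cons, List.map_cons, List.sum_cons, add_comm, ← Nat.sub_sub]
      exact isHomogeneous_iterate_pderiv i (e i) ih
  have hdeg : ((List.finRange m).map e).sum = e.degree := by
    rw [Finsupp.degree_eq_sum, ← List.ofFn_eq_map, List.sum_ofFn]
  simpa only [diffOp, hdeg] using h (List.finRange m)

theorem isHomogeneous_applyDiff {K : Type*} [CommSemiring K] {m : ℕ}
    {δ F : MvPolynomial (Fin m) K} {e d : ℕ} (hδ : δ.IsHomogeneous e) (hF : F.IsHomogeneous d) :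
    (applyDiff δ F).IsHomogeneous (d - e) := by
  refine IsHomogeneous.sum _ _ _ fun a ha => ?_
  have hdeg : a.degree = e := by
    rw [Finsupp.degree_eq_weight_one]
    exact hδ (mem_support_iff.mp ha)
  rw [smul_eq_C_mul, ← hdeg]
  exact (isHomogeneous_diffOp a hF).C_mul _

theorem eq_zero_of_pderiv_eq_zero {K : Type*} [Field K] [CharZero K] {σ : Type*} [Fintype σ]
    {G : MvPolynomial σ K} {k : ℕ} (hG : G.IsHomogeneous k) (hk : k ≠ 0)
    (h : ∀ i, pderiv i G = 0) : G = 0 := by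
  have euler := hG.sum_X_mul_pderiv
  simp only [h, mul_zero, Finset.sum_const_zero] at euler
  exact (smul_eq_zero_iff_right hk).mp euler.symm

/-- For `F` homogeneous of degree `d`:
(1) `Ann(F) ⊆ Ann(J_F)`;
(2) `Ann(F)_e = Ann(J_F)_e` for all `0 ≤ e ≤ d-1` (i.e. `e < d`);
(3) `Ann(J_F)_d = S_d`. -/
theorem stmt1 (K : Type*) [Field K] [CharZero K] (n d : ℕ)
    (F : MvPolynomial (Fin (n + 1)) K) (hF : F.IsHomogeneous d) :
    ({δ : MvPolynomial (Fin (n + 1)) K | applyDiff δ F = 0} ⊆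
      {δ | ∀ i, applyDiff δ (MvPolynomial.pderiv i F) = 0}) ∧
    (∀ e : ℕ, e < d →
      {δ : MvPolynomial (Fin (n + 1)) K | δ.IsHomogeneous e ∧ applyDiff δ F = 0} =
      {δ | δ.IsHomogeneous e ∧ ∀ i, applyDiff δ (MvPolynomial.pderiv i F) = 0}) ∧
    ({δ : MvPolynomial (Fin (n + 1)) K | δ.IsHomogeneous d ∧
        ∀ i, applyDiff δ (MvPolynomial.pderiv i F) = 0} =
      {δ | δ.IsHomogeneous d}) := by
  have ann_sub (δ : MvPolynomial (Fin (n + 1)) K) (h : applyDiff δ F = 0) (i : Fin (n + 1)) :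
      applyDiff δ (pderiv i F) = 0 := by
    rw [← pderiv_applyDiff, h, map_zero]
  refine ⟨ann_sub, fun e he => Set.ext fun δ => and_congr_right fun hδ => ⟨ann_sub δ, fun h => ?_⟩,
    Set.ext fun δ => and_iff_left_of_imp fun hδ i => ?_⟩
  · refine eq_zero_of_pderiv_eq_zero (isHomogeneous_applyDiff hδ hF) (by omega) fun i => ?_
    rw [pderiv_applyDiff, h i]
  · have hG := isHomogeneous_applyDiff hδ hF
    rw [Nat.sub_self, ← totalDegree_zero_iff_isHomogeneous, totalDegree_eq_zero_iff_eq_C] at hG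
    rw [← pderiv_applyDiff, hG, pderiv_C]
end

section
/- Let K be an algebraically closed field of characteristic zero, n ≥ 2 and d ≥ 3. Then the quartic-type form F_1 = x_0^{d−2}(x_0^2 + x_1^2 + ⋯ + x_n^2) ∈ K[x_0,...,x_n] satisfies rk(F_1) = prk(F_1) = (d−1)n. -/
open MvPolynomial

/-- `IsWaringDecomp F d r`: the degree-`d` form `F` lies in the linear span of the
`d`-th powers of `r` linear forms. -/
def IsWaringDecomp {K : Type*} [Field K] {m : ℕ} (F : MvPolynomial (Fin m) K)
    (d r : ℕ) : Prop :=
  ∃ ℓ : Fin r → MvPolynomial (Fin m) K,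
    (∀ j, (ℓ j).IsHomogeneous 1) ∧
    F ∈ Submodule.span K (Set.range fun j => ℓ j ^ d)

/-- The symmetric (Waring) rank of a degree-`d` form. -/
noncomputable def waringRank {K : Type*} [Field K] {m : ℕ}
    (F : MvPolynomial (Fin m) K) (d : ℕ) : ℕ :=
  sInf {r | IsWaringDecomp F d r}

/-- `IsPartialDecomp F d r`: all first partial derivatives of the degree-`d` form `F`
lie simultaneously in the span of the `(d-1)`-st powers of `r` linear forms. -/
def IsPartialDecomp {K : Type*} [Field K] {m : ℕ} (F : MvPolynomial (Fin m) K)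
    (d r : ℕ) : Prop :=
  ∃ t : Fin r → MvPolynomial (Fin m) K,
    (∀ j, (t j).IsHomogeneous 1) ∧
    ∀ i : Fin m, (MvPolynomial.pderiv i F) ∈
      Submodule.span K (Set.range fun j => t j ^ (d - 1))

/-- The partially symmetric rank of a degree-`d` form. -/
noncomputable def pWaringRank {K : Type*} [Field K] {m : ℕ}
    (F : MvPolynomial (Fin m) K) (d : ℕ) : ℕ :=
  sInf {r | IsPartialDecomp F d r}

namespace Polynomial

theorem exists_separable_add_C {K : Type*} [Field K] [IsAlgClosed K] [CharZero K] (f : K[X])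
    (hf : derivative f ≠ 0) : ∃ g : K, (f + C g).Separable := by
  classical
  obtain ⟨g, hg⟩ := Infinite.exists_notMem_finset
    ((derivative f).roots.toFinset.image fun w => -f.eval w)
  refine ⟨g, ?_⟩
  rw [Separable, isCoprime_iff_aeval_ne_zero_of_isAlgClosed K K]
  intro w
  by_contra! hw
  refine hg (Finset.mem_image.mpr ⟨w, ?_, ?_⟩)
  · simpa [hf] using hw.2
  · have := hw.1
    simp only [map_add, aeval_C, Algebra.algebraMap_self, RingHom.id_apply, coe_aeval_eq_eval] at this
    linear_combination -this

theorem exists_monic_separable {K : Type*} [Field K] [IsAlgClosed K] [CharZero K] (N : ℕ) {σ : K}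
    (hσ : σ ≠ 0) : ∃ p : K[X], p.Monic ∧ p.natDegree = N + 2 ∧ p.Separable ∧
      p.coeff (N + 1) = 0 ∧ p.coeff N = -σ := by
  rcases N with _ | N
  · refine ⟨X ^ 2 - C σ, monic_X_pow_sub_C _ two_ne_zero, natDegree_X_pow_sub_C,
      separable_X_pow_sub_C σ (by norm_num) hσ, ?_, ?_⟩ <;> simp [coeff_X_pow, coeff_C]
  · obtain ⟨g, hg⟩ := exists_separable_add_C (X ^ (N + 3) - C σ * X ^ (N + 1)) (by
      intro h
      have := congrArg (coeff · (N + 2)) h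
      simp only [derivative_sub, derivative_X_pow, derivative_C_mul, coeff_sub, coeff_C_mul,
        coeff_X_pow, coeff_zero] at this
      simp at this
      norm_cast at this)
    have hd : (-(C σ * X ^ (N + 1)) + C g : K[X]).degree < (N + 3 : ℕ) := by
      have : (-(C σ * X ^ (N + 1)) + C g : K[X]).natDegree ≤ N + 1 := by compute_degree
      refine degree_le_natDegree.trans_lt ?_
      exact_mod_cast this.trans_lt (by omega)
    have e : (X ^ (N + 3) - C σ * X ^ (N + 1) + C g : K[X]) =
      X ^ (N + 3) + (-(C σ * X ^ (N + 1)) + C g) := by ring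
    refine ⟨_, e ▸ monic_X_pow_add hd, ?_, hg, ?_, ?_⟩
    · rw [e, natDegree_eq_of_degree_eq_some]
      rw [degree_add_eq_left_of_degree_lt (by simpa using hd), degree_X_pow]
    · simp [coeff_X_pow]
    · simp [coeff_X_pow]

theorem exists_nodes_weights {K : Type*} [Field K] [IsAlgClosed K] [CharZero K] (N : ℕ) {κ τ : K}
    (hκ : κ ≠ 0) (hτ : τ ≠ 0) : ∃ u c : Fin (N + 2) → K,
      (∀ l < N + 1, ∑ j, c j * u j ^ l = 0) ∧ ∑ j, c j * u j ^ (N + 1) = κ ∧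
      ∑ j, c j * u j ^ (N + 2) = 0 ∧ ∑ j, c j * u j ^ (N + 3) = τ := by
  classical
  obtain ⟨p, hm, hd, hs, h1, h2⟩ := exists_monic_separable N (div_ne_zero hτ hκ)
  have hcard : p.roots.toFinset.card = N + 2 := by
    rw [Multiset.toFinset_card_of_nodup (nodup_roots hs), IsAlgClosed.card_roots_eq_natDegree, hd]
  let e := p.roots.toFinset.equivFinOfCardEq hcard
  let u : Fin (N + 2) → K := fun j => e.symm j
  have hu : Function.Injective u := Subtype.val_injective.comp e.symm.injective
  have hroot j : p.eval (u j) = 0 := by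
    have := (e.symm j).2
    rw [Multiset.mem_toFinset, mem_roots hm.ne_zero] at this
    exact this
  have hpow j : u j ^ (N + 2) =
      τ / κ * u j ^ N - ∑ l ∈ Finset.range N, p.coeff l * u j ^ l := by
    have := hroot j
    rw [eval_eq_sum_range, hd, Finset.sum_range_succ, Finset.sum_range_succ,
      Finset.sum_range_succ, h1, h2, ← hd, hm.coeff_natDegree, hd] at this
    linear_combination this
  have hdet : IsUnit (Matrix.vandermonde u).det :=
    (Matrix.det_vandermonde_ne_zero_iff.mpr hu).isUnit
  let c := Matrix.vecMul (Pi.single (Fin.last (N + 1)) κ) (Matrix.vandermonde u)⁻¹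
  have hc : Matrix.vecMul c (Matrix.vandermonde u) = Pi.single (Fin.last (N + 1)) κ := by
    rw [Matrix.vecMul_vecMul, Matrix.nonsing_inv_mul _ hdet, Matrix.vecMul_one]
  have hsum (l : Fin (N + 2)) :
      ∑ j, c j * u j ^ (l : ℕ) = (Pi.single (Fin.last (N + 1)) κ : Fin (N + 2) → K) l := by
    rw [← hc]
    rfl
  have hlt : ∀ l < N + 1, ∑ j, c j * u j ^ l = 0 := fun l hl => by
    have := hsum ⟨l, by omega⟩
    rwa [Pi.single_eq_of_ne (by simp [Fin.ext_iff]; omega)] at this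
  have htop : ∑ j, c j * u j ^ (N + 1) = κ := by simpa using hsum (Fin.last (N + 1))
  have hrec (r : ℕ) (hr : r ≤ 1) :
      ∑ j, c j * u j ^ (N + 2 + r) = τ / κ * ∑ j, c j * u j ^ (N + r) := by
    have htail : ∑ l ∈ Finset.range N, p.coeff l * ∑ j, c j * u j ^ (l + r) = 0 :=
      Finset.sum_eq_zero fun l hl => by
        rw [hlt _ (by have := Finset.mem_range.mp hl; omega), mul_zero]
    rw [← sub_zero (τ / κ * _), ← htail]
    simp_rw [pow_add _ (N + 2), hpow, Finset.mul_sum]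
    rw [Finset.sum_comm, ← Finset.sum_sub_distrib]
    refine Finset.sum_congr rfl fun j _ => ?_
    rw [sub_mul, mul_sub, Finset.sum_mul, Finset.mul_sum]
    congr 1
    · ring
    · exact Finset.sum_congr rfl fun l _ => by ring
  refine ⟨u, c, hlt, htop, ?_, ?_⟩
  · simpa [hlt N (by omega)] using hrec 0 zero_le_one
  · have := hrec 1 le_rfl
    rwa [htop, div_mul_cancel₀ _ hκ] at this

end Polynomial

theorem exists_sum_pow_eq {K A : Type*} [Field K] [IsAlgClosed K] [CharZero K] [CommRing A]
    [Algebra K A] (N : ℕ) {a : K} (ha : a ≠ 0) : ∃ u c : Fin (N + 2) → K, ∀ x y : A,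
      ∑ j, c j • (u j • x + y) ^ (N + 3) = x ^ (N + 1) * (a • x ^ 2 + y ^ 2) := by
  have hchoose : ((N + 3).choose (N + 1) : K) ≠ 0 :=
    Nat.cast_ne_zero.mpr (Nat.choose_pos (by omega)).ne'
  obtain ⟨u, c, hlt, h1, h2, h3⟩ := Polynomial.exists_nodes_weights N (inv_ne_zero hchoose) ha
  refine ⟨u, c, fun x y => ?_⟩
  have expand : ∑ j, c j • (u j • x + y) ^ (N + 3) = ∑ l ∈ Finset.range (N + 4),
      (((N + 3).choose l : K) * ∑ j, c j * u j ^ l) • (x ^ l * y ^ (N + 3 - l)) := by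
    simp_rw [add_pow, Finset.smul_sum]
    rw [Finset.sum_comm]
    refine Finset.sum_congr rfl fun l _ => ?_
    rw [Finset.mul_sum, Finset.sum_smul]
    refine Finset.sum_congr rfl fun j _ => ?_
    simp only [Algebra.smul_def, map_mul, map_pow, map_natCast]
    ring
  rw [expand, Finset.sum_range_succ, Finset.sum_range_succ, Finset.sum_range_succ,
    Finset.sum_eq_zero fun l hl => by rw [hlt l (Finset.mem_range.mp hl), mul_zero, zero_smul],
    h1, h2, h3, mul_inv_cancel₀ hchoose, Nat.choose_self,
    show N + 3 - (N + 1) = 2 by omega, show N + 3 - (N + 3) = 0 by omega]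
  simp only [Algebra.smul_def, map_mul, map_natCast]
  simp
  ring

open Module in
theorem finrank_add_finrank_le_of_map_le_span_singleton {K E : Type*} [Field K] [AddCommGroup E]
    [Module K E] (f : E →ₗ[K] E) {U V W : Submodule K E} [FiniteDimensional K W]
    (hV : V ≤ W.map f) (hU : U ≤ W) (y : E) (hUy : U.map f ≤ Submodule.span K {y}) :
    finrank K V + finrank K U ≤ finrank K W + 1 := by
  have : FiniteDimensional K U := Submodule.finiteDimensional_of_le hU
  have rank_nullity (S : Submodule K E) [FiniteDimensional K S] :
      finrank K (S.map f) + finrank K (LinearMap.ker f ⊓ S : Submodule K E) = finrank K S := by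
    have h := LinearMap.finrank_range_add_finrank_ker (f.domRestrict S)
    rw [LinearMap.range_domRestrict, LinearMap.ker_domRestrict,
      ← Submodule.finrank_map_subtype_eq S, Submodule.map_comap_subtype, inf_comm] at h
    exact h
  have hW := rank_nullity W
  have hU' := rank_nullity U
  have h1 : finrank K V ≤ finrank K (W.map f) := Submodule.finrank_mono hV
  have h2 : finrank K (U.map f) ≤ 1 :=
    (Submodule.finrank_mono hUy).trans
    ((finrank_span_le_card ({y} : Set E)).trans (by simp))
  have h3 : finrank K (LinearMap.ker f ⊓ U : Submodule K E) ≤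
      finrank K (LinearMap.ker f ⊓ W : Submodule K E) :=
    Submodule.finrank_mono (inf_le_inf_left _ hU)
  omega

namespace MvPolynomial

variable {K : Type*} [Field K] {m : ℕ}

/-- The span of the `k`-th powers of a family of polynomials. -/
noncomputable def powSpan {ι : Type*} (t : ι → MvPolynomial (Fin m) K) (k : ℕ) :
    Submodule K (MvPolynomial (Fin m) K) :=
  Submodule.span K (Set.range fun j => t j ^ k)

theorem exists_eq_sum_C_mul_X_of_isHomogeneous_one {t : MvPolynomial (Fin m) K}
    (ht : t.IsHomogeneous 1) : ∃ a : Fin m → K, t = ∑ i, C (a i) * X i := by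
  have h i : ∃ c, pderiv i t = C c :=
    ⟨_, totalDegree_eq_zero_iff_eq_C.mp (totalDegree_zero_iff_isHomogeneous _ |>.mpr ht.pderiv)⟩
  choose a ha using h
  refine ⟨a, ?_⟩
  have := ht.sum_X_mul_pderiv
  rw [one_smul] at this
  rw [← this]
  simp [ha, mul_comm]

theorem derivation_sum_C_mul_X
    (D : Derivation K (MvPolynomial (Fin m) K) (MvPolynomial (Fin m) K)) (b : Fin m → K)
    (hD : ∀ i, D (X i) = C (b i)) (a : Fin m → K) :
    D (∑ i, C (a i) * X i) = C (∑ i, a i * b i) := by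
  simp [hD, ← smul_eq_C_mul, map_sum]

theorem map_powSpan_le {ι : Type*} {t : ι → MvPolynomial (Fin m) K} {s : ι → K}
    (D : Derivation K (MvPolynomial (Fin m) K) (MvPolynomial (Fin m) K))
    (hD : ∀ j, D (t j) = C (s j)) (k : ℕ) :
    (powSpan t (k + 1)).map D.toLinearMap ≤ powSpan t k := by
  rw [powSpan, Submodule.map_span_le]
  rintro _ ⟨j, rfl⟩
  have : D (t j ^ (k + 1)) = ((k + 1 : K) * s j) • t j ^ k := by
    simp [Derivation.leibniz_pow, hD, smul_eq_C_mul]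
    ring
  exact this ▸ Submodule.smul_mem _ _ (Submodule.subset_span ⟨j, rfl⟩)

theorem le_map_powSpan [CharZero K] {ι : Type*} {t : ι → MvPolynomial (Fin m) K} {s : ι → K}
    (D : Derivation K (MvPolynomial (Fin m) K) (MvPolynomial (Fin m) K))
    (hD : ∀ j, D (t j) = C (s j)) (hs : ∀ j, s j ≠ 0) (k : ℕ) :
    powSpan t k ≤ (powSpan t (k + 1)).map D.toLinearMap := by
  rw [powSpan, Submodule.span_le]
  rintro _ ⟨j, rfl⟩
  have h : D (t j ^ (k + 1)) = ((k + 1 : K) * s j) • t j ^ k := by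
    simp [Derivation.leibniz_pow, hD, smul_eq_C_mul]
    ring
  have h0 : (k + 1 : K) * s j ≠ 0 := mul_ne_zero (by exact_mod_cast k.succ_ne_zero) (hs j)
  refine ⟨((k + 1 : K) * s j)⁻¹ • t j ^ (k + 1),
    Submodule.smul_mem _ _ (Submodule.subset_span ⟨j, rfl⟩), ?_⟩
  change D _ = _
  rw [D.map_smul, h, smul_smul, inv_mul_cancel₀ h0, one_smul]

theorem X_pow_mul_sub_mem_powSpan [CharZero K] {n : ℕ} {ι : Type*}
    {t : ι → MvPolynomial (Fin (n + 1)) K} (a : ι → Fin (n + 1) → K)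
    (ht : ∀ j, t j = ∑ i, C (a j i) * X i) (k : ℕ) {i : Fin n} {c : K}
    (h : X 0 ^ (k + 1) * X i.succ - C c * X 0 ^ (k + 2) ∈ powSpan t (k + 2)) :
    X 0 ^ (k + 1) ∈ powSpan t (k + 1) ∧ X 0 ^ k * X i.succ ∈ powSpan t (k + 1) := by
  have hp (l : Fin (n + 1)) (j : ι) : pderiv l (t j) = C (∑ i, a j i * (Pi.single l 1 : Fin (n + 1) → K) i) := by
    rw [ht]
    refine derivation_sum_C_mul_X _ _ (fun i => ?_) _
    simp [pderiv_X, Pi.single_apply, apply_ite C, eq_comm]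
  have hi := map_powSpan_le (pderiv i.succ) (hp i.succ) _ (Submodule.mem_map_of_mem h)
  have h0 := map_powSpan_le (pderiv 0) (hp 0) _ (Submodule.mem_map_of_mem h)
  have hi' : X 0 ^ (k + 1) ∈ powSpan t (k + 1) := by
    convert hi using 1
    simp [Derivation.leibniz, Derivation.leibniz_pow, pderiv_X_of_ne (Fin.succ_ne_zero i).symm]
  refine ⟨hi', ?_⟩
  have h1 : (k + 1 : K) ≠ 0 := by exact_mod_cast k.succ_ne_zero
  have e : X 0 ^ k * X i.succ = (k + 1 : K)⁻¹ • (pderiv 0 (X 0 ^ (k + 1) * X i.succ -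
      C c * X 0 ^ (k + 2)) + (c * (k + 2)) • X 0 ^ (k + 1)) := by
    rw [eq_inv_smul_iff₀ h1]
    simp [Derivation.leibniz, Derivation.leibniz_pow, pderiv_X_of_ne (Fin.succ_ne_zero i),
      smul_eq_C_mul, show (C 2 : MvPolynomial (Fin (n + 1)) K) = 2 from map_ofNat C 2]
    ring
  rw [e]
  exact Submodule.smul_mem _ _ (Submodule.add_mem _ h0 (Submodule.smul_mem _ _ hi'))

theorem finrank_span_X_pow_mul_X (k : ℕ) {n : ℕ} :
    Module.finrank K (Submodule.span K (Set.range fun i : Fin (n + 1) =>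
      (X 0 ^ k * X i : MvPolynomial (Fin (n + 1)) K))) = n + 1 := by
  have h : LinearIndependent K fun i : Fin (n + 1) =>
      (X 0 ^ k * X i : MvPolynomial (Fin (n + 1)) K) :=
    (linearIndependent_X (Fin (n + 1)) K).map' (LinearMap.mulLeft K (X 0 ^ k))
      (LinearMap.ker_eq_bot.mpr (mul_right_injective₀ (pow_ne_zero _ (X_ne_zero _))))
  simpa using finrank_span_eq_card h

theorem finrank_span_X_pow_mul_X_sub (k : ℕ) {n : ℕ} (c : Fin n → K) :
    Module.finrank K (Submodule.span K (Set.range fun i : Fin n =>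
      (X 0 ^ k * X i.succ - C (c i) * X 0 ^ (k + 1) : MvPolynomial (Fin (n + 1)) K))) = n := by
  have h : LinearIndependent K fun i : Fin n =>
      (X 0 ^ k * X i.succ - C (c i) * X 0 ^ (k + 1) : MvPolynomial (Fin (n + 1)) K) := by
    rw [Fintype.linearIndependent_iff]
    intro g hg i
    have := congrArg (pderiv i.succ) hg
    simpa [Derivation.leibniz, Derivation.leibniz_pow, pderiv_X, Pi.single_apply, Fin.succ_ne_zero]
      using this
  simpa using finrank_span_eq_card h

theorem mul_le_card_of_mem_powSpan [CharZero K] {n k : ℕ} {ι : Type*} [Fintype ι]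
    {t : ι → MvPolynomial (Fin (n + 1)) K} (a : ι → Fin (n + 1) → K)
    (ht : ∀ j, t j = ∑ i, C (a j i) * X i) (hn : 0 < n)
    (ha : ∀ j, (fun i : Fin n => a j i.succ) ≠ 0) (c : Fin n → K)
    (h : ∀ i : Fin n, X 0 ^ (k + 1) * X i.succ - C (c i) * X 0 ^ (k + 2) ∈ powSpan t (k + 2)) :
    (k + 2) * n ≤ Fintype.card ι := by
  obtain ⟨f, hf⟩ := Module.exists_dual_forall_apply_ne_zero (K := K) _ ha
  let b : Fin (n + 1) → K := Fin.cons 0 fun i => f fun j => if i = j then 1 else 0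
  let D : Derivation K (MvPolynomial (Fin (n + 1)) K) (MvPolynomial (Fin (n + 1)) K) :=
    mkDerivation K fun i => C (b i)
  have hDX i : D (X i) = C (b i) := mkDerivation_X _ _ _
  have hD0 : D (X 0) = 0 := by simp [hDX, b]
  have hDt j : D (t j) = C (f fun i => a j i.succ) := by
    rw [ht, derivation_sum_C_mul_X D b hDX, Fin.sum_univ_succ,
      LinearMap.pi_apply_eq_sum_univ f]
    simp [b]
  have : ∀ k, FiniteDimensional K (powSpan t k) := fun k =>
    FiniteDimensional.span_of_finite K (Set.finite_range _)
  have key (l : ℕ) (hl : l ≤ k) (i : Fin n) :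
      ∃ c, X 0 ^ (l + 1) * X i.succ - C c * X 0 ^ (l + 2) ∈ powSpan t (l + 2) := by
    induction hl using Nat.decreasingInduction with
    | self => exact ⟨c i, h i⟩
    | of_succ l _ ih =>
      obtain ⟨c, hc⟩ := ih
      exact ⟨0, by simpa using (X_pow_mul_sub_mem_powSpan a ht _ hc).2⟩
  have hX (l : ℕ) (hl : l ≤ k) (i : Fin (n + 1)) : X 0 ^ l * X i ∈ powSpan t (l + 1) := by
    refine Fin.cases ?_ (fun i => ?_) i
    · obtain ⟨c, hc⟩ := key l hl ⟨0, hn⟩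
      simpa [pow_succ] using (X_pow_mul_sub_mem_powSpan a ht _ hc).1
    · obtain ⟨c, hc⟩ := key l hl i
      exact (X_pow_mul_sub_mem_powSpan a ht _ hc).2
  have step (l : ℕ) (hl : l ≤ k + 1) : l * n + 1 ≤ Module.finrank K (powSpan t l) := by
    induction l with
    | zero =>
      rw [zero_mul, zero_add, Nat.one_le_iff_ne_zero, ne_eq, Submodule.finrank_eq_zero]
      intro h0
      have h1 := hX 0 (Nat.zero_le _) 0
      rcases isEmpty_or_nonempty ι with _ | ⟨⟨j⟩⟩
      · rw [powSpan, Set.range_eq_empty, Submodule.span_empty, Submodule.mem_bot] at h1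
        simp [X_ne_zero] at h1
      · have : t j ^ 0 ∈ powSpan t 0 := Submodule.subset_span ⟨j, rfl⟩
        simp [h0] at this
    | succ l ih =>
      have hU := finrank_span_X_pow_mul_X (K := K) l (n := n)
      have := finrank_add_finrank_le_of_map_le_span_singleton D.toLinearMap
        (le_map_powSpan D hDt hf l)
        (U := Submodule.span K (Set.range fun i : Fin (n + 1) => X 0 ^ l * X i))
        (Submodule.span_le.mpr (by rintro _ ⟨i, rfl⟩; exact hX l (by omega) i)) (X 0 ^ l) ?_
      · have := ih (by omega)
        rw [add_mul]
        omega
      · rw [Submodule.map_span_le]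
        rintro _ ⟨i, rfl⟩
        rw [Submodule.mem_span_singleton]
        exact ⟨b i, by simp [Derivation.leibniz_pow, hD0, hDX, smul_eq_C_mul, mul_comm]⟩
  have hU := finrank_span_X_pow_mul_X_sub (k + 1) c
  have hlast := finrank_add_finrank_le_of_map_le_span_singleton D.toLinearMap
    (le_map_powSpan D hDt hf (k + 1))
    (U := Submodule.span K (Set.range fun i : Fin n =>
      (X 0 ^ (k + 1) * X i.succ - C (c i) * X 0 ^ (k + 2) : MvPolynomial (Fin (n + 1)) K)))
    (Submodule.span_le.mpr (by rintro _ ⟨i, rfl⟩; exact h i)) (X 0 ^ (k + 1)) ?_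
  · have h1 := step (k + 1) le_rfl
    have h2 : Module.finrank K (powSpan t (k + 2)) ≤ Fintype.card ι := finrank_range_le_card _
    have h3 : (k + 2) * n = (k + 1) * n + n := by ring
    change _ ≤ Module.finrank K (powSpan t (k + 2)) + 1 at hlast
    rw [hU] at hlast
    omega
  · rw [Submodule.map_span_le]
    rintro _ ⟨i, rfl⟩
    rw [Submodule.mem_span_singleton]
    exact ⟨b i.succ, by
      simp [Derivation.leibniz_pow, hD0, hDX, smul_eq_C_mul, mul_comm]⟩

theorem IsWaringDecomp.isPartialDecomp {K : Type*} [Field K] {m : ℕ}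
    {F : MvPolynomial (Fin m) K} {d r : ℕ} (h : IsWaringDecomp F (d + 1) r) :
    IsPartialDecomp F (d + 1) r := by
  obtain ⟨t, ht, hF⟩ := h
  refine ⟨t, ht, fun i => ?_⟩
  have hs j : ∃ s, pderiv i (t j) = C s :=
    ⟨_, totalDegree_eq_zero_iff_eq_C.mp (totalDegree_zero_iff_isHomogeneous _ |>.mpr (ht j).pderiv)⟩
  choose s hs using hs
  exact map_powSpan_le (pderiv i) hs d (Submodule.mem_map_of_mem hF)

theorem isWaringDecomp_X_pow_mul_sum_sq (K : Type*) [Field K] [IsAlgClosed K] [CharZero K]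
    {n : ℕ} (hn : n ≠ 0) (N : ℕ) :
    IsWaringDecomp (X 0 ^ (N + 1) * ∑ i, X i ^ 2 : MvPolynomial (Fin (n + 1)) K)
      (N + 3) ((N + 2) * n) := by
  have hn' : (n : K) ≠ 0 := Nat.cast_ne_zero.mpr hn
  obtain ⟨u, c, h⟩ := exists_sum_pow_eq (A := MvPolynomial (Fin (n + 1)) K) N (inv_ne_zero hn')
  let ℓ : Fin (N + 2) × Fin n → MvPolynomial (Fin (n + 1)) K := fun q => u q.1 • X 0 + X q.2.succ
  have hF : (X 0 ^ (N + 1) * ∑ i, X i ^ 2 : MvPolynomial (Fin (n + 1)) K) =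
      ∑ i : Fin n, ∑ j, c j • ℓ (j, i) ^ (N + 3) := by
    simp_rw [ℓ, h]
    rw [← Finset.mul_sum, Finset.sum_add_distrib, Fin.sum_univ_succ, Finset.sum_const,
      Finset.card_univ, Fintype.card_fin, ← Nat.cast_smul_eq_nsmul K, smul_smul,
      mul_inv_cancel₀ hn', one_smul]
  refine ⟨fun q => ℓ (finProdFinEquiv.symm q), fun q => ?_, ?_⟩
  · refine IsHomogeneous.add ?_ (isHomogeneous_X K _)
    rw [smul_eq_C_mul]
    exact isHomogeneous_C_mul_X _ _
  · rw [hF]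
    refine Submodule.sum_mem _ fun i _ => Submodule.sum_mem _ fun j _ => Submodule.smul_mem _ _
      (Submodule.subset_span ⟨finProdFinEquiv (j, i), ?_⟩)
    simp only [Equiv.symm_apply_apply]

theorem le_of_isPartialDecomp_X_pow_mul_sum_sq {K : Type*} [Field K] [CharZero K] {n N r : ℕ}
    (hn : 0 < n) (h : IsPartialDecomp
      (X 0 ^ (N + 1) * ∑ i, X i ^ 2 : MvPolynomial (Fin (n + 1)) K) (N + 3) r) :
    (N + 2) * n ≤ r := by
  classical
  obtain ⟨t, ht, hF⟩ := h
  choose a ha using fun j => exists_eq_sum_C_mul_X_of_isHomogeneous_one (ht j)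
  let S := {j : Fin r // (fun i : Fin n => a j i.succ) ≠ 0}
  let W := powSpan (fun j : S => t j) (N + 2)
  have hsup : powSpan t (N + 2) ≤ W ⊔ Submodule.span K {X 0 ^ (N + 2)} := by
    rw [powSpan, Submodule.span_le]
    rintro _ ⟨j, rfl⟩
    by_cases hj : (fun i : Fin n => a j i.succ) = 0
    · refine Submodule.mem_sup_right (Submodule.mem_span_singleton.mpr ⟨a j 0 ^ (N + 2), ?_⟩)
      have h0 (i : Fin n) : a j i.succ = 0 := congrFun hj i
      simp [ha j, Fin.sum_univ_succ, h0, mul_pow, smul_eq_C_mul]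
    · exact Submodule.mem_sup_left (Submodule.subset_span ⟨⟨j, hj⟩, rfl⟩)
  have hG (i : Fin n) : ∃ c : K,
      X 0 ^ (N + 1) * X i.succ - C c * X 0 ^ (N + 2) ∈ W := by
    have hmem : X 0 ^ (N + 1) * X i.succ ∈ powSpan t (N + 2) := by
      have h2 : (2 : K) ≠ 0 := two_ne_zero
      have e : (X 0 ^ (N + 1) * X i.succ : MvPolynomial (Fin (n + 1)) K) =
          (2 : K)⁻¹ • pderiv i.succ (X 0 ^ (N + 1) * ∑ i, X i ^ 2) := by
        rw [eq_inv_smul_iff₀ h2]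
        simp [Derivation.leibniz, Derivation.leibniz_pow, pderiv_X, Pi.single_apply,
          (Fin.succ_ne_zero i).symm, smul_eq_C_mul,
          show (C 2 : MvPolynomial (Fin (n + 1)) K) = 2 from map_ofNat C 2]
        ring
      rw [e]
      exact Submodule.smul_mem _ _ (hF i.succ)
    obtain ⟨w, hw, y, hy, hwy⟩ := Submodule.mem_sup.mp (hsup hmem)
    obtain ⟨c, rfl⟩ := Submodule.mem_span_singleton.mp hy
    refine ⟨c, ?_⟩
    rwa [← hwy, smul_eq_C_mul, add_sub_cancel_right]
  choose c hc using hG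
  have := mul_le_card_of_mem_powSpan (fun j : S => a j) (fun j => ha j) hn (fun j => j.2) c hc
  exact this.trans ((Fintype.card_subtype_le _).trans (Fintype.card_fin r).le)

end MvPolynomial

/-- For `n ≥ 2`, `d ≥ 3`, the form
`F₁ = x₀^{d−2}(x₀² + x₁² + ⋯ + x_n²)` satisfies `rk(F₁) = prk(F₁) = (d−1)n`. -/
theorem stmt7 (K : Type*) [Field K] [IsAlgClosed K] [CharZero K] (n d : ℕ)
    (hn : 2 ≤ n) (hd : 3 ≤ d) :
    waringRank ((X 0) ^ (d - 2) * (∑ i : Fin (n + 1), X i ^ 2) :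
        MvPolynomial (Fin (n + 1)) K) d = (d - 1) * n ∧
    pWaringRank ((X 0) ^ (d - 2) * (∑ i : Fin (n + 1), X i ^ 2) :
        MvPolynomial (Fin (n + 1)) K) d = (d - 1) * n := by
  obtain ⟨N, rfl⟩ := Nat.exists_eq_add_of_le' hd
  change waringRank (X 0 ^ (N + 1) * _) (N + 3) = (N + 2) * n ∧
    pWaringRank (X 0 ^ (N + 1) * _) (N + 3) = (N + 2) * n
  have hupper := isWaringDecomp_X_pow_mul_sum_sq K (n := n) (by omega) N
  have hlower {r : ℕ} (h : IsPartialDecomp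
      (X 0 ^ (N + 1) * ∑ i, X i ^ 2 : MvPolynomial (Fin (n + 1)) K) (N + 3) r) :
      (N + 2) * n ≤ r := le_of_isPartialDecomp_X_pow_mul_sum_sq (by omega) h
  exact ⟨le_antisymm (Nat.sInf_le hupper)
      (le_csInf ⟨_, hupper⟩ fun _ h => hlower h.isPartialDecomp),
    le_antisymm (Nat.sInf_le hupper.isPartialDecomp)
      (le_csInf ⟨_, hupper.isPartialDecomp⟩ fun _ h => hlower h)⟩
end

section
/- Let K be an algebraically closed field of characteristic zero, n ≥ 2 and d ≥ 3. Then F_2 = x_0^{d−2}(x_1^2 + ⋯ + x_n^2) ∈ K[x_0,...,x_n] satisfies rk(F_2) = prk(F_2) = (d−1)n. -/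
open MvPolynomial

section LowerBound

/-- A family indexed by `ι × Fin N` is linearly independent if it pairs with some functionals
through a block anti-triangular matrix with nonzero scalar antidiagonal blocks. -/
theorem linearIndependent_of_antitriangular_pairing {K V ι : Type*} [Field K] [AddCommGroup V]
    [Module K V] [Fintype ι] [DecidableEq ι] {N : ℕ} {f : ι × Fin N → V}
    {w : ι → Fin N → Module.Dual K V} {c : K} (hc : c ≠ 0)
    (h_lt : ∀ i l (k p : Fin N), (k : ℕ) + p + 1 < N → w i k (f (l, p)) = 0)
    (h_eq : ∀ i l (k p : Fin N), (k : ℕ) + p + 1 = N →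
      w i k (f (l, p)) = if i = l then c else 0) :
    LinearIndependent K f := by
  rw [Fintype.linearIndependent_iff]
  intro g hg
  have key : ∀ m, ∀ (l : ι) (p : Fin N), N - 1 - (p : ℕ) = m → g (l, p) = 0 := by
    intro m
    induction m using Nat.strong_induction_on with
    | _ m ih =>
      intro l p hp
      have hz := congrArg (w l p.rev) hg
      rw [map_sum, map_zero, Finset.sum_eq_single (l, p)] at hz
      · rw [map_smul, h_eq l l p.rev p (by rw [Fin.val_rev]; omega)] at hz
        simpa [hc] using hz
      · rintro ⟨i, q⟩ - hne
        rw [map_smul]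
        rcases lt_trichotomy (q : ℕ) p with h | h | h
        · rw [h_lt l i p.rev q (by rw [Fin.val_rev]; omega), smul_zero]
        · have hq : q = p := Fin.ext h
          subst hq
          rw [h_eq l i q.rev q (by rw [Fin.val_rev]; omega), if_neg, smul_zero]
          rintro rfl
          exact hne rfl
        · rw [ih _ (by omega) i q rfl, zero_smul]
      · simp
  rintro ⟨l, p⟩
  exact key _ l p rfl

theorem MvPolynomial.IsHomogeneous.exists_eq_sum_succ {K : Type*} [CommSemiring K] {n : ℕ}
    {t : MvPolynomial (Fin (n + 1)) K} (ht : t.IsHomogeneous 1) :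
    ∃ (a : K) (m : Fin n → K), t = C a * X 0 + ∑ i, C (m i) * X i.succ := by
  have h : t ∈ homogeneousSubmodule (Fin (n + 1)) K 1 := ht
  rw [homogeneousSubmodule_one_eq_span_X, Submodule.mem_span_range_iff_exists_fun] at h
  obtain ⟨c, rfl⟩ := h
  exact ⟨c 0, fun i => c i.succ, by simp [Fin.sum_univ_succ, smul_eq_C_mul]⟩

variable {K : Type*} [Field K] [CharZero K]

/-- The moment equations satisfied by a simultaneous decomposition of the monomials
`2 x₀ᵉ xᵢ` into powers of the linear forms `aⱼ x₀ + mⱼ`. -/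
theorem sum_moments_eq {n r e : ℕ} {a : Fin r → K} {m : Fin r → Fin n → K} {c : Fin r → K}
    {i : Fin n}
    (h : ∑ j, c j • (C (a j) * X 0 + ∑ l, C (m j l) * X l.succ) ^ (e + 1) =
      (2 * X 0 ^ e * X i.succ : MvPolynomial (Fin (n + 1)) K))
    (τ : Fin n → K) (l : Fin n) {k : ℕ} (hk : k ≤ e) :
    ∑ j, c j * m j l * a j ^ k * (∑ q, m j q * τ q) ^ (e - k) =
      if k = e then (if i = l then 2 / (e + 1 : K) else 0) else 0 := by
  have he : (e + 1 : K) ≠ 0 := by exact_mod_cast e.succ_ne_zero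
  have hd : ∀ j, pderiv l.succ (C (a j) * X 0 + ∑ q, C (m j q) * X q.succ :
      MvPolynomial (Fin (n + 1)) K) = C (m j l) := by
    intro j
    simp [pderiv_X, Pi.single_apply, Derivation.leibniz, (Fin.succ_ne_zero l).symm]
  let ψ : MvPolynomial (Fin (n + 1)) K →ₐ[K] Polynomial K :=
    aeval (Fin.cons 1 fun q => Polynomial.C (τ q) * Polynomial.X)
  have hψ : ∀ j, ψ (C (a j) * X 0 + ∑ q, C (m j q) * X q.succ) =
      Polynomial.C (∑ q, m j q * τ q) * Polynomial.X + Polynomial.C (a j) := by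
    intro j
    simp only [ψ, map_add, map_mul, map_sum, aeval_X, Fin.cons_zero, Fin.cons_succ, algHom_C,
      Polynomial.algebraMap_eq, Finset.sum_mul, mul_one, mul_assoc]
    rw [add_comm]
  have hr : pderiv l.succ (2 * X 0 ^ e * X i.succ : MvPolynomial (Fin (n + 1)) K) =
      if i = l then 2 * X 0 ^ e else 0 := by
    have h2 : (2 : MvPolynomial (Fin (n + 1)) K) = C 2 := (map_ofNat C 2).symm
    rw [h2]
    simp [pderiv_X, Pi.single_apply, Derivation.leibniz, Derivation.leibniz_pow,
      (Fin.succ_ne_zero l).symm]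
  have h1 := congrArg (fun F => (ψ (pderiv l.succ F)).coeff (e - k)) h
  have hlhs : ∀ j, (ψ (pderiv l.succ (c j • (C (a j) * X 0 + ∑ q, C (m j q) * X q.succ :
      MvPolynomial (Fin (n + 1)) K) ^ (e + 1)))).coeff (e - k) =
      (e + 1) * e.choose k * (c j * m j l * a j ^ k * (∑ q, m j q * τ q) ^ (e - k)) := by
    intro j
    rw [Derivation.map_smul, Derivation.leibniz_pow, hd]
    simp only [map_smul, map_nsmul, map_mul, map_pow, smul_eq_mul, hψ, Nat.add_sub_cancel]
    have hC : ψ (C (m j l)) = Polynomial.C (m j l) := by simp [ψ]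
    rw [hC, Polynomial.coeff_smul, Polynomial.coeff_smul, Polynomial.coeff_mul_C]
    have hcomp : (Polynomial.C (∑ q, m j q * τ q) * Polynomial.X + Polynomial.C (a j)) ^ e =
        ((Polynomial.X + Polynomial.C (a j)) ^ e).comp
          (Polynomial.C (∑ q, m j q * τ q) * Polynomial.X) := by simp
    rw [hcomp, Polynomial.comp_C_mul_X_coeff, Polynomial.coeff_X_add_C_pow, Nat.sub_sub_self hk,
      Nat.choose_symm hk]
    simp
    ring
  simp only [map_sum, Polynomial.finsetSum_coeff, hlhs, ← Finset.mul_sum, hr] at h1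
  have hch : (e.choose k : K) ≠ 0 := by exact_mod_cast (Nat.choose_pos hk).ne'
  apply mul_left_cancel₀ (mul_ne_zero he hch)
  rw [h1]
  by_cases hil : i = l
  · have h2 : (2 : Polynomial K) = Polynomial.C 2 := (map_ofNat Polynomial.C 2).symm
    simp only [hil, if_true, ψ, map_mul, map_pow, aeval_X, Fin.cons_zero, one_pow, mul_one,
      map_ofNat]
    rw [h2, Polynomial.coeff_C]
    by_cases hke : k = e
    · simp only [hke, Nat.sub_self, if_true, Nat.choose_self, Nat.cast_one, mul_one]
      field_simp
    · rw [if_neg (by omega), if_neg hke, mul_zero]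
  · simp [hil]

/-- A form whose partial derivatives are `2 x₀ᵉ xᵢ` has partially symmetric rank at least
`(e + 1) n`. -/
theorem mul_le_of_mem_span_pow {n r e : ℕ}
    {t : Fin r → MvPolynomial (Fin (n + 1)) K} (ht : ∀ j, (t j).IsHomogeneous 1)
    (h : ∀ i : Fin n, (2 * X 0 ^ e * X i.succ : MvPolynomial (Fin (n + 1)) K) ∈
      Submodule.span K (Set.range fun j => t j ^ (e + 1))) :
    (e + 1) * n ≤ r := by
  choose a m hm using fun j => (ht j).exists_eq_sum_succ
  simp only [Submodule.mem_span_range_iff_exists_fun, hm] at h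
  choose c hc using h
  obtain ⟨φ, hφ⟩ := Module.exists_dual_forall_apply_ne_zero (K := K)
    (fun j : {j // m j ≠ 0} => m j) (fun j => j.2)
  set τ : Fin n → K := fun q => φ (Pi.single q 1)
  have hτ : ∀ v : Fin n → K, φ v = ∑ q, v q * τ q := fun v => by
    conv_lhs => rw [pi_eq_sum_univ' v]
    simp [τ]
  let f : Fin n × Fin (e + 1) → Fin r → K := fun x j => m j x.1 * (a j / φ (m j)) ^ (x.2 : ℕ)
  let w : Fin n → Fin (e + 1) → Module.Dual K (Fin r → K) := fun i k =>
    ∑ j, (c i j * φ (m j) ^ e * (a j / φ (m j)) ^ (k : ℕ)) • LinearMap.proj j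
  have hw : ∀ i l (k p : Fin (e + 1)), (k : ℕ) + p ≤ e → w i k (f (l, p)) =
      if (k : ℕ) + p = e then (if i = l then 2 / (e + 1 : K) else 0) else 0 := by
    intro i l k p hkp
    rw [← sum_moments_eq (hc i) τ l hkp]
    simp only [w, f, LinearMap.sum_apply, LinearMap.smul_apply, LinearMap.proj_apply, smul_eq_mul]
    refine Finset.sum_congr rfl fun j _ => ?_
    rw [← hτ]
    by_cases hj : m j = 0
    · simp [hj]
    · have hu : φ (m j) ≠ 0 := hφ ⟨j, hj⟩
      obtain ⟨s, hs⟩ := Nat.exists_eq_add_of_le hkp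
      have hsub : e - ((k : ℕ) + p) = s := by omega
      have hpow : φ (m j) ^ e = φ (m j) ^ (k : ℕ) * φ (m j) ^ (p : ℕ) * φ (m j) ^ s := by
        rw [← pow_add, ← pow_add, ← hs]
      rw [hsub, hpow, div_pow, div_pow, pow_add]
      field_simp
  have hli : LinearIndependent K f := by
    refine linearIndependent_of_antitriangular_pairing (w := w) (c := 2 / (e + 1 : K)) ?_ ?_ ?_
    · exact div_ne_zero two_ne_zero (by exact_mod_cast e.succ_ne_zero)
    · intro i l k p hkp
      rw [hw i l k p (by omega), if_neg (by omega)]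
    · intro i l k p hkp
      rw [hw i l k p (by omega), if_pos (by omega)]
  have hcard := hli.fintype_card_le_finrank
  simp only [Fintype.card_prod, Fintype.card_fin, Module.finrank_fin_fun] at hcard
  rwa [mul_comm]

end LowerBound

section UpperBound

/-- Roots of unity filter: for `N ≥ 2`, a combination of `N` powers of linear forms equal to a
multiple of `x ^ (N - 1) * y ^ 2`, up to a multiple of `x ^ 3` when `N = 2`. -/
theorem IsPrimitiveRoot.sum_mul_add_pow {R : Type*} [CommRing R] [IsDomain R] {N : ℕ} (hN : 2 ≤ N)
    {ω : R} (hω : IsPrimitiveRoot ω N) (x y : R) :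
    ∑ j : Fin N, ω ^ ((N - 2) * (j : ℕ)) * (x + ω ^ (j : ℕ) * y) ^ (N + 1) =
      N * (N + 1).choose 2 * x ^ (N - 1) * y ^ 2 + if N = 2 then N * x ^ (N + 1) else 0 := by
  have hsum : ∀ s : ℕ, ∑ j : Fin N, ω ^ (s * (j : ℕ)) = if N ∣ s then (N : R) else 0 := by
    intro s
    simp only [pow_mul]
    rw [Fin.sum_univ_eq_sum_range (fun j => (ω ^ s) ^ j)]
    split_ifs with h
    · simp [(hω.pow_eq_one_iff_dvd s).2 h]
    · have h1 : ω ^ s - 1 ≠ 0 := fun h0 => h ((hω.pow_eq_one_iff_dvd s).1 (sub_eq_zero.1 h0))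
      apply mul_right_cancel₀ h1
      rw [geom_sum_mul, ← pow_mul, mul_comm s, pow_mul, hω.pow_eq_one]
      simp
  have hexp : ∀ j : Fin N, ω ^ ((N - 2) * (j : ℕ)) * (x + ω ^ (j : ℕ) * y) ^ (N + 1) =
      ∑ k ∈ Finset.range (N + 2), ω ^ ((N - 2 + k) * (j : ℕ)) *
        (x ^ (N + 1 - k) * y ^ k * (N + 1).choose k) := by
    intro j
    rw [add_comm x, add_pow, Finset.mul_sum]
    refine Finset.sum_congr rfl fun k _ => ?_
    rw [mul_pow, ← pow_mul, add_mul, pow_add, mul_comm (j : ℕ) k]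
    ring
  simp only [hexp]
  rw [Finset.sum_comm]
  simp only [← Finset.sum_mul, hsum, ite_mul, zero_mul]
  obtain rfl | hN' := hN.eq_or_lt
  · simp [Finset.sum_range_succ, Nat.choose]
    ring
  · rw [Finset.sum_eq_single 2]
    · rw [if_pos (by rw [Nat.sub_add_cancel hN]), if_neg hN'.ne',
        show N + 1 - 2 = N - 1 by omega]
      ring
    · intro k hk hk2
      rw [Finset.mem_range] at hk
      rw [if_neg]
      rintro ⟨q, hq⟩
      have h1 : q ≠ 0 := by rintro rfl; omega
      have h2 : q ≠ 1 := by rintro rfl; omega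
      have : N * 2 ≤ N * q := Nat.mul_le_mul_left N (by omega)
      omega
    · intro h
      exact absurd (Finset.mem_range.2 (by omega)) h

/-- In an algebraically closed field of characteristic zero, there are `n ≥ 2` nonzero elements
whose inverse squares sum to zero. -/
theorem exists_sum_inv_sq_eq_zero (K : Type*) [Field K] [IsAlgClosed K] [CharZero K] {n : ℕ}
    (hn : 2 ≤ n) : ∃ s : Fin n → K, (∀ i, s i ≠ 0) ∧ ∑ i, (s i ^ 2)⁻¹ = 0 := by
  obtain ⟨k, rfl⟩ := Nat.exists_eq_add_of_le' hn
  obtain ⟨z, hz⟩ := IsAlgClosed.exists_pow_nat_eq (-(k + 1 : K)⁻¹) (n := 2) two_pos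
  have hk : (k + 1 : K) ≠ 0 := by exact_mod_cast k.succ_ne_zero
  refine ⟨Fin.cons z fun _ => 1, ?_, ?_⟩
  · intro i
    refine Fin.cases ?_ (fun i => ?_) i
    · rintro h
      rw [Fin.cons_zero] at h
      rw [h] at hz
      simp [hk] at hz
    · simp
  · rw [Fin.sum_univ_succ]
    simp [hz, inv_neg]

theorem isWaringDecomp_pow_mul_sum_sq (K : Type*) [Field K] [IsAlgClosed K] [CharZero K]
    {n N : ℕ} (hn : 2 ≤ n) (hN : 2 ≤ N) :
    IsWaringDecomp (X 0 ^ (N - 1) * ∑ i : Fin n, X i.succ ^ 2 : MvPolynomial (Fin (n + 1)) K)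
      (N + 1) (N * n) := by
  have : NeZero (N : K) := ⟨by exact_mod_cast (by omega : N ≠ 0)⟩
  obtain ⟨ω, hω⟩ := HasEnoughRootsOfUnity.exists_primitiveRoot K N
  obtain ⟨s, hs, hsum⟩ := exists_sum_inv_sq_eq_zero K hn
  let L : Fin N × Fin n → MvPolynomial (Fin (n + 1)) K := fun x =>
    X 0 + C ω ^ (x.1 : ℕ) * (C (s x.2) * X x.2.succ)
  refine ⟨L ∘ finProdFinEquiv.symm, fun j => ?_, ?_⟩
  · refine (isHomogeneous_X K 0).add ?_
    rw [← mul_assoc, ← C_pow, ← C_mul]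
    exact isHomogeneous_C_mul_X _ _
  have hrange : Set.range (fun j => (L ∘ finProdFinEquiv.symm) j ^ (N + 1)) =
      Set.range fun x => L x ^ (N + 1) :=
    finProdFinEquiv.symm.surjective.range_comp (fun x => L x ^ (N + 1))
  rw [hrange]
  have hω' : IsPrimitiveRoot (C ω : MvPolynomial (Fin (n + 1)) K) N :=
    hω.map_of_injective (C_injective _ _)
  set M : K := N * (N + 1).choose 2 with hM
  have hM0 : M ≠ 0 := mul_ne_zero (NeZero.ne _) (by exact_mod_cast (Nat.choose_pos (by omega)).ne')
  have key : M • (X 0 ^ (N - 1) * ∑ i : Fin n, X i.succ ^ 2 : MvPolynomial (Fin (n + 1)) K) =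
      ∑ i : Fin n, ∑ j : Fin N, ((s i ^ 2)⁻¹ * ω ^ ((N - 2) * (j : ℕ))) • L (j, i) ^ (N + 1) := by
    have hin : ∀ i : Fin n,
        ∑ j : Fin N, ((s i ^ 2)⁻¹ * ω ^ ((N - 2) * (j : ℕ))) • L (j, i) ^ (N + 1) =
        M • (X 0 ^ (N - 1) * X i.succ ^ 2) +
          C (s i ^ 2)⁻¹ * if N = 2 then (N : MvPolynomial (Fin (n + 1)) K) * X 0 ^ (N + 1)
            else 0 := by
      intro i
      have h := hω'.sum_mul_add_pow hN (X 0) (C (s i) * X i.succ)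
      have h1 : C (s i ^ 2)⁻¹ * C (s i) ^ 2 = (1 : MvPolynomial (Fin (n + 1)) K) := by
        rw [← C_pow, ← C_mul, inv_mul_cancel₀ (pow_ne_zero 2 (hs i)), C_1]
      simp only [mul_smul, smul_eq_C_mul, C_pow, L]
      rw [← Finset.mul_sum, h, hM, mul_add]
      simp only [C_mul, map_natCast]
      linear_combination (N * (N + 1).choose 2 * X 0 ^ (N - 1) * X i.succ ^ 2) * h1
    simp only [hin]
    rw [Finset.sum_add_distrib, ← Finset.sum_mul, ← map_sum, hsum, C_0, zero_mul, add_zero,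
      ← Finset.smul_sum, Finset.mul_sum]
  rw [← Submodule.smul_mem_iff _ hM0, key]
  exact Submodule.sum_mem _ fun i _ => Submodule.sum_mem _ fun j _ =>
    Submodule.smul_mem _ _ (Submodule.subset_span ⟨(j, i), rfl⟩)

/-- Differentiating a Waring decomposition gives a simultaneous decomposition of the partial
derivatives. -/
theorem IsWaringDecomp.isPartialDecomp {K : Type*} [Field K] {m : ℕ}
    {F : MvPolynomial (Fin m) K} {d r : ℕ} (h : IsWaringDecomp F d r) : IsPartialDecomp F d r := by
  obtain ⟨ℓ, hℓ, hF⟩ := h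
  refine ⟨ℓ, hℓ, fun i => ?_⟩
  rw [Submodule.mem_span_range_iff_exists_fun] at hF
  obtain ⟨c, rfl⟩ := hF
  rw [map_sum]
  refine Submodule.sum_mem _ fun j _ => ?_
  obtain ⟨b, hb⟩ : ∃ b : K, pderiv i (ℓ j) = C b := by
    have h0 : (pderiv i (ℓ j)).IsHomogeneous 0 := (hℓ j).pderiv
    exact ⟨_, totalDegree_eq_zero_iff_eq_C.1 (Nat.le_zero.1 h0.totalDegree_le)⟩
  have : pderiv i (c j • ℓ j ^ d) = (c j * d * b) • ℓ j ^ (d - 1) := by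
    rw [Derivation.map_smul, Derivation.leibniz_pow, hb]
    simp only [smul_eq_C_mul, C_mul, map_natCast, smul_eq_mul, nsmul_eq_mul]
    ring
  rw [this]
  exact Submodule.smul_mem _ _ (Submodule.subset_span ⟨j, rfl⟩)

end UpperBound

theorem IsPartialDecomp.mul_le {K : Type*} [Field K] [CharZero K] {n N r : ℕ} (hN : 1 ≤ N)
    (h : IsPartialDecomp
      (X 0 ^ (N - 1) * ∑ i : Fin n, X i.succ ^ 2 : MvPolynomial (Fin (n + 1)) K) (N + 1) r) :
    N * n ≤ r := by
  obtain ⟨e, rfl⟩ := Nat.exists_eq_add_of_le' hN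
  obtain ⟨t, ht, hmem⟩ := h
  simp only [Nat.add_sub_cancel] at hmem
  refine mul_le_of_mem_span_pow ht fun i => ?_
  convert hmem i.succ using 1
  have : ∀ x : Fin n, (pderiv i.succ) (X x.succ ^ 2 : MvPolynomial (Fin (n + 1)) K) =
      if x = i then 2 * X i.succ else 0 := by
    intro x
    rw [Derivation.leibniz_pow, pderiv_X]
    by_cases hx : x = i
    · simp [hx]
    · simp [hx]
  simp [Derivation.leibniz, Derivation.leibniz_pow, pderiv_X, this,
    (Fin.succ_ne_zero i).symm]
  ring

/-- For `n ≥ 2`, `d ≥ 3`, the form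
`F₂ = x₀^{d−2}(x₁² + ⋯ + x_n²)` satisfies `rk(F₂) = prk(F₂) = (d−1)n`. -/
theorem stmt8 (K : Type*) [Field K] [IsAlgClosed K] [CharZero K] (n d : ℕ)
    (hn : 2 ≤ n) (hd : 3 ≤ d) :
    waringRank ((X 0) ^ (d - 2) *
        (∑ i ∈ Finset.univ.filter (fun i : Fin (n + 1) => 1 ≤ (i : ℕ)), X i ^ 2) :
        MvPolynomial (Fin (n + 1)) K) d = (d - 1) * n ∧
    pWaringRank ((X 0) ^ (d - 2) *
        (∑ i ∈ Finset.univ.filter (fun i : Fin (n + 1) => 1 ≤ (i : ℕ)), X i ^ 2) :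
        MvPolynomial (Fin (n + 1)) K) d = (d - 1) * n := by
  have hF : ∑ i ∈ Finset.univ.filter (fun i : Fin (n + 1) => 1 ≤ (i : ℕ)),
      (X i ^ 2 : MvPolynomial (Fin (n + 1)) K) = ∑ i : Fin n, X i.succ ^ 2 := by
    rw [Finset.sum_filter, Fin.sum_univ_succ]
    simp
  obtain ⟨N, rfl⟩ := Nat.exists_eq_add_of_le' (show 1 ≤ d by omega)
  have hN : 2 ≤ N := by omega
  rw [hF, Nat.add_sub_cancel, show N + 1 - 2 = N - 1 by omega]
  have hW := isWaringDecomp_pow_mul_sum_sq K hn hN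
  exact ⟨le_antisymm (Nat.sInf_le hW) (le_csInf ⟨_, hW⟩
      fun r hr => hr.isPartialDecomp.mul_le (by omega)),
    le_antisymm (Nat.sInf_le hW.isPartialDecomp) (le_csInf ⟨_, hW.isPartialDecomp⟩
      fun r hr => hr.mul_le (by omega))⟩
end

section
/- Let K be an algebraically closed field of characteristic zero, n ≥ 2, and let F = x_0x_1⋯x_n·(x_0 + x_1 + ⋯ + x_n)·(x_0^2 + x_1^2 + ⋯ + x_n^2) ∈ K[x_0,...,x_n]. Then the degree-2 graded piece of the annihilator of F is zero, Ann(F)_2 = 0, and consequently rk(F) ≥ C(n+2, 2). -/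
open MvPolynomial

section Apolarity

variable {K : Type*} [Field K] {m : ℕ}

lemma exists_coeff_iterate_pderiv [CharZero K] (i : Fin m) (k : ℕ) (F : MvPolynomial (Fin m) K)
    (t : Fin m →₀ ℕ) :
    ∃ c : K, c ≠ 0 ∧ coeff t ((⇑(pderiv i))^[k] F) = c * coeff (t + Finsupp.single i k) F := by
  induction k generalizing t with
  | zero => exact ⟨1, one_ne_zero, by simp⟩
  | succ k ih =>
    obtain ⟨c, hc, h⟩ := ih (t + Finsupp.single i 1)
    refine ⟨c * (t i + 1), mul_ne_zero hc (Nat.cast_add_one_ne_zero _), ?_⟩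
    rw [Function.iterate_succ_apply', coeff_pderiv, h, add_assoc, ← Finsupp.single_add,
      add_comm 1 k]
    ring

/-- Up to a nonzero scalar, `diffOp d` shifts coefficients by `d`. -/
lemma exists_coeff_diffOp [CharZero K] (d t : Fin m →₀ ℕ) (F : MvPolynomial (Fin m) K) :
    ∃ c : K, c ≠ 0 ∧ coeff t (diffOp d F) = c * coeff (t + d) F := by
  have key : ∀ (L : List (Fin m)) (t : Fin m →₀ ℕ), ∃ c : K, c ≠ 0 ∧
      coeff t (L.foldr (fun i G => (⇑(pderiv i))^[d i] G) F) =
        c * coeff (t + (L.map fun i => Finsupp.single i (d i)).sum) F := by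
    intro L
    induction L with
    | nil => exact fun t => ⟨1, one_ne_zero, by simp⟩
    | cons i L ih =>
      intro t
      obtain ⟨c, hc, h⟩ := exists_coeff_iterate_pderiv i (d i)
        (L.foldr (fun i G => (⇑(pderiv i))^[d i] G) F) t
      obtain ⟨c', hc', h'⟩ := ih (t + Finsupp.single i (d i))
      refine ⟨c * c', mul_ne_zero hc hc', ?_⟩
      rw [List.foldr_cons, h, h', List.map_cons, List.sum_cons, mul_assoc, add_assoc]
  have hd : ((List.finRange m).map fun i => Finsupp.single i (d i)).sum = d := by
    rw [← List.ofFn_eq_map, List.sum_ofFn, Finsupp.univ_sum_single]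
  obtain ⟨c, hc, h⟩ := key (List.finRange m) t
  exact ⟨c, hc, by rwa [hd] at h⟩

lemma iterate_pderiv_pow {ℓ : MvPolynomial (Fin m) K} {a : Fin m → K}
    (hℓ : ∀ i, pderiv i ℓ = C (a i)) (i : Fin m) (b : K) (N k : ℕ) :
    (⇑(pderiv i))^[k] (C b * ℓ ^ N) = C (b * a i ^ k * N.descFactorial k) * ℓ ^ (N - k) := by
  induction k with
  | zero => simp
  | succ k ih =>
    rw [Function.iterate_succ_apply', ih, pderiv_C_mul, pderiv_pow, hℓ, Nat.sub_sub,
      Nat.descFactorial_succ]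
    simp only [map_mul, map_pow, map_natCast, Nat.cast_mul]
    ring

lemma diffOp_pow {ℓ : MvPolynomial (Fin m) K} {a : Fin m → K}
    (hℓ : ∀ i, pderiv i ℓ = C (a i)) (d : Fin m →₀ ℕ) (N : ℕ) :
    diffOp d (ℓ ^ N) =
      C ((∏ i, a i ^ d i) * N.descFactorial d.degree) * ℓ ^ (N - d.degree) := by
  have key : ∀ L : List (Fin m), L.foldr (fun i G => (⇑(pderiv i))^[d i] G) (ℓ ^ N) =
      C ((L.map fun i => a i ^ d i).prod * N.descFactorial (L.map d).sum) *
        ℓ ^ (N - (L.map d).sum) := by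
    intro L
    induction L with
    | nil => simp
    | cons i L ih =>
      rw [List.foldr_cons, ih, iterate_pderiv_pow hℓ, List.map_cons, List.map_cons,
        List.prod_cons, List.sum_cons, Nat.sub_sub, add_comm (d i),
        ← Nat.descFactorial_mul_descFactorial (Nat.le_add_right (L.map d).sum (d i)),
        Nat.add_sub_cancel_left]
      congr 2
      push_cast
      ring
  have := key (List.finRange m)
  rwa [← List.ofFn_eq_map, ← List.ofFn_eq_map, List.prod_ofFn, List.sum_ofFn,
    ← Finsupp.degree_eq_sum] at this

lemma diffOp_add (d : Fin m →₀ ℕ) (F G : MvPolynomial (Fin m) K) :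
    diffOp d (F + G) = diffOp d F + diffOp d G := by
  unfold diffOp
  induction List.finRange m with
  | nil => rfl
  | cons i L ih => rw [List.foldr_cons, ih, iterate_map_add]; rfl

lemma diffOp_smul (d : Fin m →₀ ℕ) (c : K) (F : MvPolynomial (Fin m) K) :
    diffOp d (c • F) = c • diffOp d F := by
  unfold diffOp
  induction List.finRange m with
  | nil => rfl
  | cons i L ih =>
    rw [List.foldr_cons, ih, List.foldr_cons]
    generalize L.foldr (fun i G => (⇑(pderiv i))^[d i] G) F = G
    induction d i with
    | zero => rfl
    | succ k ih => rw [Function.iterate_succ_apply', ih, Derivation.map_smul, Function.iterate_succ_apply']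

/-- The apolarity action of a fixed `δ`, as a linear map. -/
noncomputable def applyDiffHom (δ : MvPolynomial (Fin m) K) :
    MvPolynomial (Fin m) K →ₗ[K] MvPolynomial (Fin m) K where
  toFun := applyDiff δ
  map_add' F G := by simp only [applyDiff, diffOp_add, smul_add, Finset.sum_add_distrib]
  map_smul' c F := by
    simp only [applyDiff, diffOp_smul, Finset.smul_sum, RingHom.id_apply, smul_comm c]

lemma applyDiff_pow {ℓ : MvPolynomial (Fin m) K} {a : Fin m → K}
    (hℓ : ∀ i, pderiv i ℓ = C (a i)) {δ : MvPolynomial (Fin m) K} {k : ℕ}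
    (hδ : δ.IsHomogeneous k) (N : ℕ) :
    applyDiff δ (ℓ ^ N) = C (eval a δ * N.descFactorial k) * ℓ ^ (N - k) := by
  rw [applyDiff, eval_eq', Finset.sum_mul, map_sum, Finset.sum_mul]
  refine Finset.sum_congr rfl fun d hd => ?_
  have hdk : d.degree = k := by
    by_contra h
    exact mem_support_iff.1 hd (hδ.coeff_eq_zero h)
  rw [diffOp_pow hℓ, hdk, smul_eq_C_mul, ← mul_assoc, ← C_mul, mul_assoc (coeff d δ)]

lemma exists_pderiv_eq_C {ℓ : MvPolynomial (Fin m) K} (hℓ : ℓ.IsHomogeneous 1) :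
    ∃ a : Fin m → K, ∀ i, pderiv i ℓ = C (a i) := by
  refine ⟨fun i => coeff 0 (pderiv i ℓ), fun i => ?_⟩
  exact totalDegree_eq_zero_iff_eq_C.1 (Nat.le_zero.1 hℓ.pderiv.totalDegree_le)

lemma finrank_homogeneousSubmodule (m k : ℕ) :
    Module.finrank K (homogeneousSubmodule (Fin m) K k) = (m + k - 1).choose k := by
  classical
  have e : {d : Fin m →₀ ℕ | d.degree = k} ≃ Sym (Fin m) k := (Sym.equivNatSum (Fin m) k).symm
  have : Fintype {d : Fin m →₀ ℕ | d.degree = k} := Fintype.ofEquiv _ e.symm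
  rw [homogeneousSubmodule_eq_finsupp_supported]
  refine (AddMonoidAlgebra.supportedEquivFinsupp
    {d : Fin m →₀ ℕ | d.degree = k}).finrank_eq.trans ?_
  rw [Module.finrank_finsupp_self, Fintype.card_congr e, Sym.card_sym_eq_choose, Fintype.card_fin]

/-- If no nonzero form of degree `k` annihilates `F`, then every Waring decomposition of `F` has
at least as many summands as the dimension of the space of degree `k` forms. -/
lemma choose_le_of_isWaringDecomp {F : MvPolynomial (Fin m) K} {N k r : ℕ}
    (hF : ∀ δ : MvPolynomial (Fin m) K, δ.IsHomogeneous k → applyDiff δ F = 0 → δ = 0)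
    (h : IsWaringDecomp F N r) : (m + k - 1).choose k ≤ r := by
  obtain ⟨ℓ, hℓ, hspan⟩ := h
  choose a ha using fun j => exists_pderiv_eq_C (hℓ j)
  let φ : homogeneousSubmodule (Fin m) K k →ₗ[K] Fin r → K :=
    LinearMap.pi fun j => (aeval (a j)).toLinearMap ∘ₗ Submodule.subtype _
  have hinj : Function.Injective φ := by
    rw [injective_iff_map_eq_zero]
    rintro ⟨δ, hδ⟩ h0
    refine Subtype.ext (hF δ hδ ?_)
    have hle : Submodule.span K (Set.range fun j => ℓ j ^ N) ≤ LinearMap.ker (applyDiffHom δ) := by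
      rw [Submodule.span_le]
      rintro _ ⟨j, rfl⟩
      have hj : eval (a j) δ = 0 := by simpa [φ] using congrFun h0 j
      change applyDiff δ (ℓ j ^ N) = 0
      rw [applyDiff_pow (ha j) hδ, hj, zero_mul, map_zero, zero_mul]
    exact hle hspan
  simpa [finrank_homogeneousSubmodule] using LinearMap.finrank_le_finrank_of_injective hinj

end Apolarity

section Existence

variable {K : Type*} [Field K]

/-- A polynomial curve contained in a subspace has all its coefficients in this subspace. -/
lemma mem_of_forall_sum_pow_smul_mem [Infinite K] {V : Type*} [AddCommGroup V] [Module K V]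
    (W : Submodule K V) (N : ℕ) (v : ℕ → V)
    (h : ∀ t : K, ∑ k ∈ Finset.range N, t ^ k • v k ∈ W) {k : ℕ} (hk : k < N) : v k ∈ W := by
  by_contra hv
  obtain ⟨f, hf, hW⟩ := Submodule.exists_le_ker_of_notMem hv
  have hp : ∑ k ∈ Finset.range N, Polynomial.monomial k (f (v k)) = 0 := by
    refine Polynomial.funext fun t => ?_
    have := hW (h t)
    rw [LinearMap.mem_ker, map_sum] at this
    simpa [Polynomial.eval_finsetSum, mul_comm] using this
  have := congrArg (Polynomial.coeff · k) hp
  simp [Polynomial.coeff_monomial, hk] at this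
  exact hf this

lemma homogeneousSubmodule_le_span_pow [CharZero K] (σ : Type*) (N : ℕ) :
    homogeneousSubmodule σ K N ≤
      Submodule.span K ((fun ℓ => ℓ ^ N) '' {ℓ : MvPolynomial σ K | ℓ.IsHomogeneous 1}) := by
  rw [← homogeneousSubmodule_one_pow]
  induction N with
  | zero =>
    rw [pow_zero, Submodule.one_le]
    exact Submodule.subset_span ⟨0, isHomogeneous_zero _ _ _, pow_zero _⟩
  | succ N ih =>
    rw [pow_succ']
    refine (mul_le_mul_right ih _).trans ?_
    rw [← Submodule.span_eq (homogeneousSubmodule σ K 1), Submodule.span_mul_span,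
      Submodule.span_le]
    rintro _ ⟨x, hx, _, ⟨y, hy, rfl⟩, rfl⟩
    set W := Submodule.span K
      ((fun ℓ => ℓ ^ (N + 1)) '' {ℓ : MvPolynomial σ K | ℓ.IsHomogeneous 1}) with hW
    have key := mem_of_forall_sum_pow_smul_mem W (N + 1 + 1)
      (fun k => ((N + 1).choose k : K) • (x ^ k * y ^ (N + 1 - k))) (fun t => by
        have hmem : (t • x + y) ^ (N + 1) ∈ W :=
          Submodule.subset_span ⟨t • x + y,
            (homogeneousSubmodule σ K 1).add_mem ((homogeneousSubmodule σ K 1).smul_mem t hx) hy,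
            rfl⟩
        rw [add_pow] at hmem
        convert hmem using 2 with k
        simp only [smul_eq_C_mul, mul_pow, map_pow, map_natCast]
        ring) (k := 1) (by omega)
    have hne : ((N + 1 : ℕ) : K) ≠ 0 := Nat.cast_ne_zero.2 N.succ_ne_zero
    simpa [hne] using (W.smul_mem_iff (by simpa using hne)).1 key

lemma exists_isWaringDecomp [CharZero K] {m N : ℕ} {F : MvPolynomial (Fin m) K}
    (hF : F.IsHomogeneous N) : ∃ r, IsWaringDecomp F N r := by
  obtain ⟨T, hT, hFT⟩ := Submodule.mem_span_finite_of_mem_span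
    (homogeneousSubmodule_le_span_pow (Fin m) N hF)
  choose g hg hgT using fun x : T => hT x.2
  refine ⟨T.card, fun j => g (T.equivFin.symm j), fun j => hg _, ?_⟩
  refine Submodule.span_mono ?_ hFT
  intro x hx
  exact ⟨T.equivFin ⟨x, hx⟩, by simpa using hgT ⟨x, hx⟩⟩

/-- If no nonzero form of degree `k` annihilates the form `F`, then its Waring rank is at least
the dimension of the space of degree `k` forms. -/
lemma choose_le_waringRank [CharZero K] {m N k : ℕ} {F : MvPolynomial (Fin m) K}
    (hN : F.IsHomogeneous N)
    (hF : ∀ δ : MvPolynomial (Fin m) K, δ.IsHomogeneous k → applyDiff δ F = 0 → δ = 0) :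
    (m + k - 1).choose k ≤ waringRank F N :=
  choose_le_of_isWaringDecomp hF (Nat.sInf_mem (exists_isWaringDecomp hN))

end Existence

section ProductForm

variable {K : Type*} [Field K]

lemma isHomogeneous_prod_X_mul_sum_mul_sum_sq (m : ℕ) :
    ((∏ i : Fin m, X i) * (∑ i : Fin m, X i) * (∑ i : Fin m, X i ^ 2) :
      MvPolynomial (Fin m) K).IsHomogeneous (m + 3) := by
  have h1 : (∏ i : Fin m, X i : MvPolynomial (Fin m) K).IsHomogeneous m := by
    simpa using IsHomogeneous.prod Finset.univ (fun i => (X i : MvPolynomial (Fin m) K))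
      (fun _ => 1) fun i _ => isHomogeneous_X K i
  have h2 : (∑ i : Fin m, X i : MvPolynomial (Fin m) K).IsHomogeneous 1 :=
    IsHomogeneous.sum _ _ _ fun i _ => isHomogeneous_X K i
  have h3 : (∑ i : Fin m, X i ^ 2 : MvPolynomial (Fin m) K).IsHomogeneous 2 :=
    IsHomogeneous.sum _ _ _ fun i _ => isHomogeneous_X_pow i 2
  exact (h1.mul h2).mul h3

lemma coeff_sum_mul_sum_sq_ne_zero [CharZero K] {m : ℕ} (k l : Fin m) :
    coeff (Finsupp.single k 1 + Finsupp.single l 2)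
      ((∑ i : Fin m, X i) * (∑ i : Fin m, X i ^ 2) : MvPolynomial (Fin m) K) ≠ 0 := by
  classical
  have h : ∀ i j : Fin m, (X i * X j ^ 2 : MvPolynomial (Fin m) K) =
      monomial (Finsupp.single i 1 + Finsupp.single j 2) 1 := fun i j => by
    rw [X_pow_eq_monomial, X, monomial_mul, mul_one]
  simp only [Finset.sum_mul_sum, coeff_sum, h, coeff_monomial]
  rw [← Finset.sum_product', Finset.sum_boole, Nat.cast_ne_zero]
  exact Finset.card_ne_zero_of_mem (a := (k, l)) (by simp)

lemma coeff_prod_X_mul {m : ℕ} (s : Fin m →₀ ℕ) (G : MvPolynomial (Fin m) K) :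
    coeff s ((∏ i : Fin m, X i) * G) =
      if ∀ i, 1 ≤ s i then coeff (s - Finsupp.equivFunOnFinite.symm 1) G else 0 := by
  have h : (∏ i : Fin m, X i : MvPolynomial (Fin m) K) =
      monomial (Finsupp.equivFunOnFinite.symm 1) 1 := by
    rw [monomial_eq, Finsupp.prod_fintype _ _ (by simp)]
    simp
  rw [h, coeff_monomial_mul', one_mul]
  exact if_congr Finsupp.le_def rfl rfl

/-- The coefficient extraction behind the vanishing of the degree-two annihilator: if a monomial
shift `t` and an exponent `d` are such that `d` is the only exponent of `δ` with `t + d` having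
full support, then `δ` has no `d` term. -/
lemma coeff_eq_zero_of_applyDiff_eq_zero [CharZero K] {m : ℕ} {δ G : MvPolynomial (Fin m) K}
    (h0 : applyDiff δ ((∏ i : Fin m, X i) * G) = 0) {t d c : Fin m →₀ ℕ}
    (htd : t + d = Finsupp.equivFunOnFinite.symm 1 + c) (hc : coeff c G ≠ 0)
    (hd : ∀ e, coeff e δ ≠ 0 → (∀ i, 1 ≤ (t + e) i) → e = d) : coeff d δ = 0 := by
  by_contra hne
  have h := congrArg (coeff t) h0
  rw [applyDiff, coeff_sum, Finset.sum_eq_single d, coeff_zero, coeff_smul] at h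
  · obtain ⟨b, hb, hbd⟩ := exists_coeff_diffOp d t ((∏ i : Fin m, X i) * G)
    rw [hbd, coeff_prod_X_mul, htd, if_pos (by simp), add_tsub_cancel_left] at h
    exact mul_ne_zero hne (mul_ne_zero hb hc) h
  · intro e he hed
    obtain ⟨b, -, hbe⟩ := exists_coeff_diffOp e t ((∏ i : Fin m, X i) * G)
    rw [coeff_smul, hbe, coeff_prod_X_mul,
      if_neg fun hs => hed (hd e (mem_support_iff.1 he) hs), mul_zero, smul_zero]
  · exact fun hs => (hs (mem_support_iff.2 hne)).elim

lemma exists_eq_single_add_single {m : ℕ} {d : Fin m →₀ ℕ} (hd : d.degree = 2) {k : Fin m}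
    (hk : d k ≠ 0) : ∃ l, d = Finsupp.single k 1 + Finsupp.single l 1 := by
  have hle : Finsupp.single k 1 ≤ d := Finsupp.single_le_iff.2 (Nat.one_le_iff_ne_zero.2 hk)
  have hdeg : (d - Finsupp.single k 1).degree = 1 := by
    have := congrArg Finsupp.degree (add_tsub_cancel_of_le hle)
    rw [map_add, Finsupp.degree_single, hd] at this
    omega
  obtain ⟨l, hl⟩ : d - Finsupp.single k 1 ∈ Set.range fun l : Fin m => Finsupp.single l 1 := by
    rw [Finsupp.range_single_one]
    exact hdeg
  exact ⟨l, by rw [show Finsupp.single l 1 = _ from hl, add_tsub_cancel_of_le hle]⟩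

lemma eq_zero_of_applyDiff_eq_zero [CharZero K] {m : ℕ} (hm : 3 ≤ m)
    {δ : MvPolynomial (Fin m) K} (hδ : δ.IsHomogeneous 2)
    (h0 : applyDiff δ ((∏ i : Fin m, X i) * (∑ i : Fin m, X i) * (∑ i : Fin m, X i ^ 2)) = 0) :
    δ = 0 := by
  classical
  rw [mul_assoc] at h0
  have hdeg : ∀ e, coeff e δ ≠ 0 → e.degree = 2 := fun e he => by
    by_contra h
    exact he (hδ.coeff_eq_zero h)
  have hoff : ∀ k l : Fin m, k ≠ l →
      coeff (Finsupp.single k 1 + Finsupp.single l 1) δ = 0 := by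
    intro k l hkl
    obtain ⟨p, hp⟩ : ∃ p, p ∉ ({k, l} : Finset (Fin m)) := by
      by_contra! h
      have := Finset.card_le_card (fun x _ => h x : Finset.univ ⊆ ({k, l} : Finset (Fin m)))
      have := Finset.card_le_two (a := k) (b := l)
      simp at *
      omega
    obtain ⟨hpk, hpl⟩ : p ≠ k ∧ p ≠ l := by simpa using hp
    refine coeff_eq_zero_of_applyDiff_eq_zero h0
      (t := Finsupp.equivFunOnFinite.symm 1 - Finsupp.single k 1 - Finsupp.single l 1 +
        (Finsupp.single p 1 + Finsupp.single p 2))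
      (c := Finsupp.single p 1 + Finsupp.single p 2) ?_ (coeff_sum_mul_sum_sq_ne_zero p p) ?_
    · ext i
      simp only [Finsupp.add_apply, Finsupp.tsub_apply, Finsupp.single_apply,
        Finsupp.equivFunOnFinite_symm_apply_apply, Pi.one_apply]
      grind
    · intro e he hs
      have hek : e k ≠ 0 := by
        have := hs k
        simp [Finsupp.single_apply, hpk] at this
        omega
      have hel : e l ≠ 0 := by
        have := hs l
        simp [Finsupp.single_apply, hpl] at this
        omega
      obtain ⟨j, rfl⟩ := exists_eq_single_add_single (hdeg e he) hek
      have : j = l := by simpa [Finsupp.single_apply, hkl] using hel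
      rw [this]
  have hdiag : ∀ k : Fin m, coeff (Finsupp.single k 1 + Finsupp.single k 1) δ = 0 := by
    intro k
    obtain ⟨p, hp⟩ : ∃ p : Fin m, p ≠ k := by
      have : Nontrivial (Fin m) := Fin.nontrivial_iff_two_le.2 (by omega)
      exact exists_ne k
    refine coeff_eq_zero_of_applyDiff_eq_zero h0
      (t := Finsupp.equivFunOnFinite.symm 1 - Finsupp.single k 1 + Finsupp.single p 2)
      (c := Finsupp.single k 1 + Finsupp.single p 2) ?_ (coeff_sum_mul_sum_sq_ne_zero k p) ?_
    · ext i
      simp only [Finsupp.add_apply, Finsupp.tsub_apply, Finsupp.single_apply,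
        Finsupp.equivFunOnFinite_symm_apply_apply, Pi.one_apply]
      grind
    · intro e he hs
      have hek : e k ≠ 0 := by
        have := hs k
        simp [hp] at this
        omega
      obtain ⟨j, rfl⟩ := exists_eq_single_add_single (hdeg e he) hek
      have : k = j := by
        by_contra h
        exact he (hoff k j h)
      rw [this]
  ext d
  rw [coeff_zero]
  by_contra hd
  obtain ⟨k, hk⟩ : ∃ k, d k ≠ 0 := by
    by_contra! h
    have : d = 0 := Finsupp.ext h
    simpa [this] using hdeg d hd
  obtain ⟨l, rfl⟩ := exists_eq_single_add_single (hdeg d hd) hk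
  obtain rfl | hkl := eq_or_ne k l
  · exact hd (hdiag k)
  · exact hd (hoff k l hkl)

end ProductForm

/-- For `n ≥ 2` and
`F = x₀⋯x_n·(x₀+⋯+x_n)·(x₀²+⋯+x_n²)` (of degree `n+4`), the degree-2 piece of the
annihilator is zero, and consequently `rk(F) ≥ C(n+2, 2)`. -/
theorem stmt10 (K : Type*) [Field K] [IsAlgClosed K] [CharZero K] (n : ℕ) (hn : 2 ≤ n) :
    ({δ : MvPolynomial (Fin (n + 1)) K | δ.IsHomogeneous 2 ∧
        applyDiff δ ((∏ i : Fin (n + 1), X i) * (∑ i : Fin (n + 1), X i) *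
          (∑ i : Fin (n + 1), X i ^ 2)) = 0} = {0}) ∧
    (n + 2).choose 2 ≤
      waringRank ((∏ i : Fin (n + 1), X i) * (∑ i : Fin (n + 1), X i) *
        (∑ i : Fin (n + 1), X i ^ 2) : MvPolynomial (Fin (n + 1)) K) (n + 4) := by
  refine ⟨?_, choose_le_waringRank (isHomogeneous_prod_X_mul_sum_mul_sum_sq (n + 1))
    fun δ hδ h0 => eq_zero_of_applyDiff_eq_zero (by omega) hδ h0⟩
  ext δ
  refine ⟨fun h => eq_zero_of_applyDiff_eq_zero (by omega) h.1 h.2, ?_⟩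
  rintro rfl
  exact ⟨isHomogeneous_zero _ _ _, by simp [applyDiff]⟩
end

section
/- Let K be an algebraically closed field of characteristic zero, let 0 < k < n, and let F = x_0x_1⋯x_k·(x_{k+1}^2 + ⋯ + x_n^2) ∈ K[x_0,...,x_n]. Then rk(F) ≥ (k+3)(n−k). -/
open MvPolynomial

/-- The span of the `d`-th powers of linear forms absorbs multiplication by a linear form, with
the exponent raised by one. -/
lemma mul_mem_span_linear_pow {K σ : Type*} [Field K] [CharZero K] {d : ℕ}
    {l p : MvPolynomial σ K} (hl : l.IsHomogeneous 1)
    (hp : p ∈ Submodule.span K {q | ∃ m : MvPolynomial σ K, m.IsHomogeneous 1 ∧ q = m ^ d}) :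
    l * p ∈ Submodule.span K
      {q | ∃ m : MvPolynomial σ K, m.IsHomogeneous 1 ∧ q = m ^ (d + 1)} := by
  induction hp using Submodule.span_induction with
  | zero => simp
  | add x y _ _ hx hy => rw [mul_add]; exact add_mem hx hy
  | smul a x _ hx => rw [mul_smul_comm]; exact Submodule.smul_mem _ _ hx
  | mem x hx =>
    obtain ⟨m, hm, rfl⟩ := hx
    by_contra hnot
    obtain ⟨φ, hφ, hker⟩ := Submodule.exists_le_ker_of_notMem hnot
    let Q : Polynomial K := ∑ i ∈ Finset.range (d + 1 + 1),
      Polynomial.C (φ (l ^ i * m ^ (d + 1 - i)) * ((d + 1).choose i : K)) * Polynomial.X ^ i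
    have hQ : Q = 0 := by
      refine Polynomial.funext fun s => ?_
      have hmem : (s • l + m) ^ (d + 1) ∈ LinearMap.ker φ :=
        hker (Submodule.subset_span ⟨_, ((homogeneousSubmodule σ K 1).add_mem
          ((homogeneousSubmodule σ K 1).smul_mem s hl) hm), rfl⟩)
      rw [LinearMap.mem_ker, add_pow, map_sum] at hmem
      rw [Polynomial.eval_zero, ← hmem, Polynomial.eval_finsetSum]
      refine Finset.sum_congr rfl fun i _ => ?_
      have hterm : (s • l) ^ i * m ^ (d + 1 - i) * (((d + 1).choose i : ℕ) : MvPolynomial σ K) =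
          (s ^ i * ((d + 1).choose i : K)) • (l ^ i * m ^ (d + 1 - i)) := by
        rw [smul_pow, smul_eq_C_mul, smul_eq_C_mul, map_mul, map_natCast]
        ring
      rw [hterm, map_smul, smul_eq_mul]
      simp
      ring
    have hcoeff := congrArg (fun q => Polynomial.coeff q 1) hQ
    simp only [Q, Polynomial.finsetSum_coeff, Polynomial.coeff_C_mul_X_pow,
      Polynomial.coeff_zero] at hcoeff
    rw [Finset.sum_ite_eq] at hcoeff
    simp only [Finset.mem_range, pow_one, Nat.add_sub_cancel, Nat.choose_one_right] at hcoeff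
    rw [if_pos (by omega)] at hcoeff
    exact (mul_ne_zero hφ (Nat.cast_ne_zero.mpr (Nat.succ_ne_zero d))) hcoeff

lemma prod_X_mul_mem_span_linear_pow {K σ : Type*} [Field K] [CharZero K] {d : ℕ}
    (s : Finset σ) {p : MvPolynomial σ K}
    (hp : p ∈ Submodule.span K {q | ∃ m : MvPolynomial σ K, m.IsHomogeneous 1 ∧ q = m ^ d}) :
    (∏ i ∈ s, X i) * p ∈ Submodule.span K
      {q | ∃ m : MvPolynomial σ K, m.IsHomogeneous 1 ∧ q = m ^ (s.card + d)} := by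
  classical
  induction s using Finset.induction_on with
  | empty => simpa using hp
  | insert a s ha ih =>
    rw [Finset.prod_insert ha, mul_assoc, Finset.card_insert_of_notMem ha, Nat.add_right_comm]
    exact mul_mem_span_linear_pow (isHomogeneous_X K a) ih

lemma exists_isWaringDecomp_of_mem_span {K : Type*} [Field K] {m d : ℕ}
    {F : MvPolynomial (Fin m) K}
    (hF : F ∈ Submodule.span K {q | ∃ l : MvPolynomial (Fin m) K, l.IsHomogeneous 1 ∧ q = l ^ d}) :
    ∃ r, IsWaringDecomp F d r := by
  obtain ⟨T, hT, hFT⟩ := Submodule.mem_span_finite_of_mem_span hF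
  choose g hg using fun x : T => hT x.2
  refine ⟨T.card, fun j => g (T.equivFin.symm j), fun j => (hg _).1, ?_⟩
  refine Submodule.span_mono (fun x hx => ?_) hFT
  exact ⟨T.equivFin ⟨x, hx⟩, by simpa using (hg ⟨x, hx⟩).2.symm⟩

/-- A linear form is a linear combination of the variables. -/
lemma exists_eq_linearCombination_X {K σ : Type*} [Field K] {l : MvPolynomial σ K}
    (hl : l.IsHomogeneous 1) :
    ∃ a : σ →₀ K, l = Finsupp.linearCombination K (X : σ → MvPolynomial σ K) a := by
  have h : l ∈ homogeneousSubmodule σ K 1 := hl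
  rw [homogeneousSubmodule_one_eq_span_X, ← Finsupp.range_linearCombination] at h
  obtain ⟨a, ha⟩ := h
  exact ⟨a, ha.symm⟩

/-- Evaluating a form of degree `d` at `a` amounts, up to `d!`, to pairing it with the `d`-th
power of the linear form with coefficients `a`. -/
lemma factorial_mul_eval_eq_sum {K σ : Type*} [Field K] {d : ℕ} {D : MvPolynomial σ K}
    (hD : D.IsHomogeneous d) (a : σ →₀ K) :
    (d.factorial : K) * eval a D = ∑ α ∈ D.support, coeff α D *
      (((∏ i ∈ α.support, (α i).factorial : ℕ) : K) *
        coeff α ((Finsupp.linearCombination K (X : σ → MvPolynomial σ K) a) ^ d)) := by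
  rw [eval_eq, Finset.mul_sum]
  refine Finset.sum_congr rfl fun α hα => ?_
  have hdeg : α.sum (fun _ m => m) = d := by
    have := hD (mem_support_iff.mp hα)
    rw [Finsupp.weight_apply] at this
    simpa using this
  have hspec := Nat.multinomial_spec α.support α
  rw [show ∑ i ∈ α.support, α i = d from hdeg, ← Finsupp.multinomial_eq] at hspec
  rw [coeff_linearCombination_X_pow, if_pos hdeg, ← hspec, Nat.cast_mul, Finsupp.prod]
  ring

/-- Moments of a Waring decomposition of `F` are given by the coefficients of `F`. -/
lemma factorial_mul_sum_eval_eq_sum {K σ ι : Type*} [Field K] [Fintype ι] {d : ℕ}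
    {D F : MvPolynomial σ K} (hD : D.IsHomogeneous d) (c : ι → K) (a : ι → σ →₀ K)
    (hF : F = ∑ j, c j • (Finsupp.linearCombination K (X : σ → MvPolynomial σ K) (a j)) ^ d) :
    (d.factorial : K) * ∑ j, c j * eval (a j) D = ∑ α ∈ D.support, coeff α D *
      (((∏ i ∈ α.support, (α i).factorial : ℕ) : K) * coeff α F) := by
  simp_rw [hF, coeff_sum, coeff_smul, smul_eq_mul, Finset.mul_sum]
  rw [Finset.sum_comm]
  refine Finset.sum_congr rfl fun j _ => ?_
  rw [mul_left_comm, factorial_mul_eval_eq_sum hD, Finset.mul_sum]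
  exact Finset.sum_congr rfl fun α _ => by ring

lemma sum_eval_eq_zero_of_weight_ne {K σ ι M : Type*} [Field K] [CharZero K] [Fintype ι]
    [AddCommMonoid M] {d : ℕ} {D F : MvPolynomial σ K} (hD : D.IsHomogeneous d) (c : ι → K)
    (a : ι → σ →₀ K)
    (hF : F = ∑ j, c j • (Finsupp.linearCombination K (X : σ → MvPolynomial σ K) (a j)) ^ d)
    {w : σ → M} {e f : M} (hDw : IsWeightedHomogeneous w D e) (hFw : IsWeightedHomogeneous w F f)
    (hef : e ≠ f) : ∑ j, c j * eval (a j) D = 0 := by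
  have h := factorial_mul_sum_eval_eq_sum hD c a hF
  rw [Finset.sum_eq_zero (s := D.support)] at h
  · exact (mul_eq_zero.mp h).resolve_left (Nat.cast_ne_zero.mpr d.factorial_ne_zero)
  · intro α hα
    rw [hFw.coeff_eq_zero α (by rwa [hDw (mem_support_iff.mp hα)]), mul_zero, mul_zero]

lemma sum_eval_monomial_ne_zero {K σ ι : Type*} [Field K] [CharZero K] [Fintype ι]
    {d : ℕ} {F : MvPolynomial σ K} {α : σ →₀ ℕ} (hα : (monomial α (1 : K)).IsHomogeneous d)
    (c : ι → K) (a : ι → σ →₀ K)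
    (hF : F = ∑ j, c j • (Finsupp.linearCombination K (X : σ → MvPolynomial σ K) (a j)) ^ d)
    (hFα : coeff α F ≠ 0) : ∑ j, c j * eval (a j) (monomial α 1) ≠ 0 := by
  classical
  have h := factorial_mul_sum_eval_eq_sum hα c a hF
  rw [support_monomial, if_neg one_ne_zero, Finset.sum_singleton, coeff_monomial, if_pos rfl,
    one_mul] at h
  intro h0
  rw [h0, mul_zero] at h
  exact mul_ne_zero (Nat.cast_ne_zero.mpr
    (Finset.prod_ne_zero_iff.mpr fun i _ => Nat.factorial_ne_zero _)) hFα h.symm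

/-- Over an infinite field, finitely many points can be separated from zero by one linear form:
`τ` is chosen supported on `Z` and nonvanishing at each `a j` that does not vanish on `Z`. -/
lemma exists_linear_form_ne_zero {K σ ι : Type*} [Field K] [CharZero K] [Fintype ι]
    (Z : Finset σ) (a : ι → σ →₀ K) :
    ∃ τ : σ → K, ∀ j, (∑ i ∈ Z, τ i * a j i = 0) → ∀ i ∈ Z, a j i = 0 := by
  classical
  let L : ι → MvPolynomial σ K := fun j => ∑ i ∈ Z, C (a j i) * X i
  have hL : ∏ j ∈ Finset.univ.filter (fun j => L j ≠ 0), L j ≠ 0 :=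
    Finset.prod_ne_zero_iff.mpr fun j hj => (Finset.mem_filter.mp hj).2
  obtain ⟨τ, hτ⟩ : ∃ τ, eval τ (∏ j ∈ Finset.univ.filter (fun j => L j ≠ 0), L j) ≠ 0 := by
    by_contra! h
    exact hL (MvPolynomial.funext fun x => by simpa using h x)
  refine ⟨τ, fun j hj i hi => ?_⟩
  have hLj : L j = 0 := by
    by_contra hne
    rw [map_prod] at hτ
    refine Finset.prod_ne_zero_iff.mp hτ j (by simp [hne]) ?_
    rw [← hj]
    simp [L, mul_comm]
  have := congrArg (coeff (Finsupp.single i 1)) hLj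
  simpa [L, coeff_sum, coeff_C_mul, coeff_X, Finsupp.single_left_inj, hi] using this

section

variable {K σ : Type*} [Field K] {A Z : Finset σ}

lemma isWeightedHomogeneous_prod_X_mul_sum_X_sq {M : Type*} [AddCommMonoid M] (w : σ → M)
    {e f : M} (hA : ∑ i ∈ A, w i = e) (hZ : ∀ i ∈ Z, 2 • w i = f) :
    IsWeightedHomogeneous w ((∏ i ∈ A, X i) * ∑ i ∈ Z, X i ^ 2 : MvPolynomial σ K) (e + f) := by
  refine IsWeightedHomogeneous.mul (hA ▸ IsWeightedHomogeneous.prod A _ _ fun i _ =>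
    isWeightedHomogeneous_X K w i) (IsWeightedHomogeneous.sum Z _ _ fun i hi => ?_)
  exact hZ i hi ▸ (isWeightedHomogeneous_X K w i).pow 2

lemma isWeightedHomogeneous_X_mul_prod_mul_prod_mul_X {M : Type*} [AddCommMonoid M] (w : σ → M)
    (S T : Finset σ) (b i : σ) :
    IsWeightedHomogeneous w
      ((X b * ∏ s ∈ S, X s) * ((∏ s ∈ T, X s) * X i) : MvPolynomial σ K)
      ((w b + ∑ s ∈ S, w s) + (∑ s ∈ T, w s + w i)) :=
  ((isWeightedHomogeneous_X K w b).mul (IsWeightedHomogeneous.prod _ _ _ fun i _ =>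
    isWeightedHomogeneous_X K w i)).mul ((IsWeightedHomogeneous.prod _ _ _ fun i _ =>
    isWeightedHomogeneous_X K w i).mul (isWeightedHomogeneous_X K w i))

variable [DecidableEq σ]

/-- The moments of a Waring decomposition of `∏_A x · ∑_Z x²` against
`x_b x_{A \ S} · x_{S'} x_i · t ^ (|S| - |S'|)` vanish unless `(S', i) = (S, b)`. -/
lemma sum_moment_eq_zero [CharZero K] (hAZ : Disjoint A Z) {ι : Type*} [Fintype ι] (c : ι → K)
    (a : ι → σ →₀ K)
    (hF : (∏ i ∈ A, X i) * ∑ i ∈ Z, X i ^ 2 = ∑ j, c j •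
      (Finsupp.linearCombination K (X : σ → MvPolynomial σ K) (a j)) ^ (A.card + 2))
    (τ : σ → K) {S S' : Finset σ} (hS : S ⊆ A) (hS' : S' ⊆ A) (hcard : S'.card ≤ S.card)
    {b i : σ} (hb : b ∈ Z) (hi : i ∈ Z) (hne : ¬ (S' = S ∧ i = b)) :
    ∑ j, c j * ((a j b * ∏ s ∈ A \ S, a j s) * ((∏ s ∈ S', a j s) * a j i) *
      (∑ l ∈ Z, τ l * a j l) ^ (S.card - S'.card)) = 0 := by
  set D : MvPolynomial σ K := ((X b * ∏ s ∈ A \ S, X s) * ((∏ s ∈ S', X s) * X i)) *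
      (∑ l ∈ Z, C (τ l) * X l) ^ (S.card - S'.card) with hDdef
  have hDw (w : σ → ℕ) (hw : ∀ l ∈ Z, w l = 1) :
      IsWeightedHomogeneous w D ((w b + ∑ s ∈ A \ S, w s) + (∑ s ∈ S', w s + w i) +
        (S.card - S'.card) • 1) := by
    refine (isWeightedHomogeneous_X_mul_prod_mul_prod_mul_X w _ _ _ _).mul
      (IsWeightedHomogeneous.pow (IsWeightedHomogeneous.sum _ _ _ fun l hl => ?_) _)
    exact hw l hl ▸ (isWeightedHomogeneous_X K w l).C_mul _
  have hDhom : D.IsHomogeneous (A.card + 2) := by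
    have h := hDw (1 : σ → ℕ) (by simp)
    have e : (1 + (A \ S).card) + (S'.card + 1) + (S.card - S'.card) = A.card + 2 := by
      have := Finset.card_sdiff_add_card_eq_card hS
      omega
    simpa [e, IsHomogeneous] using h
  have heval : ∀ j, eval (a j) D = (a j b * ∏ s ∈ A \ S, a j s) * ((∏ s ∈ S', a j s) * a j i) *
      (∑ l ∈ Z, τ l * a j l) ^ (S.card - S'.card) := fun j => by simp [hDdef]
  simp_rw [← heval]
  have hnotA : ∀ l ∈ Z, l ∉ A := fun l hl h => Finset.disjoint_left.mp hAZ h hl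
  rcases hcard.lt_or_eq with hlt | heq
  · let w : σ → ℕ := fun l => if l ∈ Z then 1 else 0
    have hwA : ∀ T ⊆ A, ∑ s ∈ T, w s = 0 := fun T hT => Finset.sum_eq_zero fun s hs =>
      if_neg (Finset.disjoint_left.mp hAZ (hT hs))
    refine sum_eval_eq_zero_of_weight_ne hDhom c a hF (hDw w fun l hl => if_pos hl)
      (isWeightedHomogeneous_prod_X_mul_sum_X_sq w (hwA A subset_rfl) (f := 2)
        fun l hl => by simp [w, hl]) ?_
    rw [hwA _ Finset.sdiff_subset, hwA _ hS']
    simp only [w, hb, hi, if_true, smul_eq_mul]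
    omega
  rw [heq, Nat.sub_self, pow_zero, mul_one] at hDdef
  by_cases hSS : S' = S
  · have hib : i ≠ b := fun h => hne ⟨hSS, h⟩
    let w : σ → ZMod 2 := fun l => if l = b then 1 else 0
    have hwA : ∀ T ⊆ A, ∑ s ∈ T, w s = 0 := fun T hT => Finset.sum_eq_zero fun s hs =>
      if_neg fun h : s = b => hnotA b hb (h ▸ hT hs)
    refine sum_eval_eq_zero_of_weight_ne hDhom c a hF
      (hDdef ▸ isWeightedHomogeneous_X_mul_prod_mul_prod_mul_X w _ _ _ _)
      (isWeightedHomogeneous_prod_X_mul_sum_X_sq w (hwA A subset_rfl) (f := 0)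
        fun l hl => by rw [two_nsmul, CharTwo.add_self_eq_zero]) ?_
    rw [hwA _ Finset.sdiff_subset, hwA _ hS']
    simp [w, hib]
  · obtain ⟨s, hsS, hsS'⟩ := Finset.not_subset.mp
      fun h : S ⊆ S' => hSS (Finset.eq_of_subset_of_card_le h heq.le).symm
    have hsZ : ∀ l ∈ Z, l ≠ s := fun l hl h => hnotA l hl (h ▸ hS hsS)
    let w : σ → ℕ := fun l => if l = s then 1 else 0
    refine sum_eval_eq_zero_of_weight_ne hDhom c a hF
      (hDdef ▸ isWeightedHomogeneous_X_mul_prod_mul_prod_mul_X w _ _ _ _)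
      (isWeightedHomogeneous_prod_X_mul_sum_X_sq w (e := 1) (f := 0)
        (by simp [w, hS hsS]) fun l hl => by simp [w, hsZ l hl]) ?_
    simp [w, hsZ b hb, hsZ i hi, hsS, hsS']

/-- The remaining moment, against `x_b² x_A`, does not vanish. -/
lemma sum_moment_ne_zero [CharZero K] {ι : Type*} [Fintype ι] (c : ι → K) (a : ι → σ →₀ K)
    (hF : (∏ i ∈ A, X i) * ∑ i ∈ Z, X i ^ 2 = ∑ j, c j •
      (Finsupp.linearCombination K (X : σ → MvPolynomial σ K) (a j)) ^ (A.card + 2))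
    {S : Finset σ} (hS : S ⊆ A) {b : σ} (hb : b ∈ Z) :
    ∑ j, c j * ((a j b * ∏ s ∈ A \ S, a j s) * ((∏ s ∈ S, a j s) * a j b)) ≠ 0 := by
  have hprod : (∏ i ∈ A, X i : MvPolynomial σ K) =
      monomial (∑ i ∈ A, Finsupp.single i 1) 1 := by
    rw [monomial_sum_one]; rfl
  have hmono (i : σ) : (∏ i ∈ A, X i : MvPolynomial σ K) * X i ^ 2 =
      monomial (∑ i ∈ A, Finsupp.single i 1 + Finsupp.single i 2) 1 := by
    rw [hprod, X_pow_eq_monomial, monomial_mul, one_mul]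
  have heval (j : ι) : eval (a j) (monomial (∑ i ∈ A, Finsupp.single i 1 + Finsupp.single b 2) 1) =
      (a j b * ∏ s ∈ A \ S, a j s) * ((∏ s ∈ S, a j s) * a j b) := by
    rw [← hmono, ← Finset.prod_sdiff hS]
    simp
    ring
  simp_rw [← heval]
  refine sum_eval_monomial_ne_zero ?_ c a hF ?_
  · rw [← hmono]
    refine IsHomogeneous.mul ?_ (isHomogeneous_X_pow b 2)
    simpa using IsHomogeneous.prod A (fun i => (X i : MvPolynomial σ K)) (fun _ => 1)
      fun i _ => isHomogeneous_X K i
  · rw [Finset.mul_sum, coeff_sum, Finset.sum_eq_single b]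
    · simp [hmono]
    · intro i _ hib
      rw [hmono, coeff_monomial, if_neg]
      simp [Finsupp.single_left_inj, hib]
    · exact fun h => absurd hb h

/-- Any Waring decomposition of `∏_A x · ∑_Z x²` has at least `2 ^ |A| * |Z|` summands. -/
lemma two_pow_mul_card_le_of_eq_sum [CharZero K] (hAZ : Disjoint A Z) {ι : Type*} [Fintype ι]
    (c : ι → K) (a : ι → σ →₀ K)
    (hF : (∏ i ∈ A, X i) * ∑ i ∈ Z, X i ^ 2 = ∑ j, c j •
      (Finsupp.linearCombination K (X : σ → MvPolynomial σ K) (a j)) ^ (A.card + 2)) :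
    2 ^ A.card * Z.card ≤ Fintype.card ι := by
  obtain ⟨τ, hτ⟩ := exists_linear_form_ne_zero Z a
  let t : ι → K := fun j => ∑ l ∈ Z, τ l * a j l
  let f : A.powerset × Z → ι → K := fun q j =>
    ((∏ s ∈ (q.1 : Finset σ), a j s) * a j q.2) / t j ^ ((q.1 : Finset σ).card + 1)
  have hli : LinearIndependent K f := by
    rw [Fintype.linearIndependent_iff]
    intro g hg
    suffices h : ∀ n : ℕ, ∀ q : A.powerset × Z, A.card - (q.1 : Finset σ).card = n → g q = 0 from
      fun q => h _ q rfl
    intro n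
    induction n using Nat.strong_induction_on with
    | _ n ih =>
      intro q hq
      have hqA := Finset.mem_powerset.mp q.1.2
      let T : ι → K := fun j => c j * ((a j q.2 * ∏ s ∈ A \ q.1, a j s) *
        t j ^ ((q.1 : Finset σ).card + 1))
      have hTf (p : A.powerset × Z) (hp : (p.1 : Finset σ).card ≤ (q.1 : Finset σ).card) (j : ι) :
          T j * f p j = c j * ((a j q.2 * ∏ s ∈ A \ q.1, a j s) *
            ((∏ s ∈ (p.1 : Finset σ), a j s) * a j p.2) *
            t j ^ ((q.1 : Finset σ).card - (p.1 : Finset σ).card)) := by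
        by_cases ht : t j = 0
        · simp [T, hτ j ht q.2 q.2.2]
        · have hpow : t j ^ ((q.1 : Finset σ).card + 1) = t j ^ ((p.1 : Finset σ).card + 1) *
              t j ^ ((q.1 : Finset σ).card - (p.1 : Finset σ).card) := by
            rw [← pow_add]; congr 1; omega
          simp only [T, f]
          rw [hpow]
          field_simp
      have hsum : ∑ p, g p * ∑ j, T j * f p j = 0 := by
        simp_rw [Finset.mul_sum]
        rw [Finset.sum_comm]
        refine Finset.sum_eq_zero fun j _ => ?_
        have hj := congrFun hg j
        simp only [Finset.sum_apply, Pi.smul_apply, smul_eq_mul, Pi.zero_apply] at hj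
        rw [← mul_zero (T j), ← hj, Finset.mul_sum]
        exact Finset.sum_congr rfl fun p _ => by ring
      rw [Finset.sum_eq_single q] at hsum
      · refine (mul_eq_zero.mp hsum).resolve_right ?_
        simp_rw [hTf q le_rfl, Nat.sub_self, pow_zero, mul_one]
        exact sum_moment_ne_zero c a hF hqA q.2.2
      · intro p _ hpq
        have hpA := Finset.mem_powerset.mp p.1.2
        rcases le_or_gt (p.1 : Finset σ).card (q.1 : Finset σ).card with hle | hlt
        · simp_rw [hTf p hle]
          rw [sum_moment_eq_zero hAZ c a hF τ hqA hpA hle q.2.2 p.2.2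
            fun h => hpq (Prod.ext (Subtype.ext h.1) (Subtype.ext h.2)), mul_zero]
        · have := Finset.card_le_card hpA
          rw [ih _ (by omega) p rfl, zero_mul]
      · exact fun h => absurd (Finset.mem_univ q) h
  simpa using hli.fintype_card_le_finrank

end

lemma two_pow_mul_card_le_of_isWaringDecomp {K : Type*} [Field K] [CharZero K] {m r : ℕ}
    {A Z : Finset (Fin m)} (hAZ : Disjoint A Z)
    (h : IsWaringDecomp ((∏ i ∈ A, X i) * ∑ i ∈ Z, X i ^ 2 : MvPolynomial (Fin m) K)
      (A.card + 2) r) : 2 ^ A.card * Z.card ≤ r := by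
  obtain ⟨l, hl, hF⟩ := h
  choose a ha using fun j => exists_eq_linearCombination_X (hl j)
  obtain ⟨c, hc⟩ := (Submodule.mem_span_range_iff_exists_fun K).mp hF
  simp_rw [ha] at hc
  simpa using two_pow_mul_card_le_of_eq_sum hAZ c a hc.symm

lemma exists_isWaringDecomp_prod_X_mul_sum_X_sq {K : Type*} [Field K] [CharZero K] {m : ℕ}
    (A Z : Finset (Fin m)) :
    ∃ r, IsWaringDecomp ((∏ i ∈ A, X i) * ∑ i ∈ Z, X i ^ 2 : MvPolynomial (Fin m) K)
      (A.card + 2) r :=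
  exists_isWaringDecomp_of_mem_span <| prod_X_mul_mem_span_linear_pow A <|
    Submodule.sum_mem _ fun i _ => Submodule.subset_span ⟨X i, isHomogeneous_X K i, rfl⟩

/-- For `0 < k < n` and
`F = x₀x₁⋯x_k·(x_{k+1}² + ⋯ + x_n²)` (a form of degree `k+3`),
one has `rk(F) ≥ (k+3)(n−k)`. -/
theorem stmt11 (K : Type*) [Field K] [IsAlgClosed K] [CharZero K] (n k : ℕ)
    (hk0 : 0 < k) (hkn : k < n) :
    (k + 3) * (n - k) ≤
      waringRank ((∏ i ∈ Finset.univ.filter (fun i : Fin (n + 1) => (i : ℕ) ≤ k), X i) *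
        (∑ i ∈ Finset.univ.filter (fun i : Fin (n + 1) => k < (i : ℕ)), X i ^ 2) :
        MvPolynomial (Fin (n + 1)) K) (k + 3) := by
  set A := Finset.univ.filter (fun i : Fin (n + 1) => (i : ℕ) ≤ k)
  set Z := Finset.univ.filter (fun i : Fin (n + 1) => k < (i : ℕ))
  have hAZ : Disjoint A Z :=
    Finset.disjoint_filter.mpr fun i _ h => not_lt.mpr h
  have hA : A.card = k + 1 := by
    have h : A = Finset.Iic (⟨k, by omega⟩ : Fin (n + 1)) := by
      ext i
      simp [A, Fin.le_def]
    rw [h, Fin.card_Iic]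
  have hZ : Z.card = n - k := by
    have h : Z = Finset.Ioi (⟨k, by omega⟩ : Fin (n + 1)) := by
      ext i
      simp [Z, Fin.lt_def]
    rw [h, Fin.card_Ioi]
    simp
  have hk : k + 3 ≤ 2 ^ (k + 1) := by
    obtain ⟨j, rfl⟩ := Nat.exists_eq_add_of_le' hk0
    have := Nat.lt_two_pow_self (n := j)
    rw [pow_succ, pow_succ]
    omega
  rw [show k + 3 = A.card + 2 by omega]
  refine le_csInf (exists_isWaringDecomp_prod_X_mul_sum_X_sq A Z) fun r hr => ?_
  have := two_pow_mul_card_le_of_isWaringDecomp hAZ hr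
  rw [hA, hZ] at this
  rw [hA]
  exact (Nat.mul_le_mul_right _ hk).trans this
end

section
/- Let K be an algebraically closed field of characteristic zero and n ≥ 5. Then the degree-n form F = x_0^{n−3}x_1·(x_2^2 + ⋯ + x_n^2) ∈ K[x_0,...,x_n] satisfies n(n−1) ≤ rk(F) ≤ 2n(n−2). -/
open MvPolynomial

section Moments

variable {K A ι : Type*} [Field K] [CommRing A] [Algebra K A]

/-- The monomial `u ^ α * ∏ y i ^ β i`. -/
def monom (u : A) (y : ι → A) (α : ℕ) (β : ι →₀ ℕ) : A :=
  u ^ α * β.prod fun i e => y i ^ e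

lemma monom_mul (u : A) (y : ι → A) (α α' : ℕ) (β β' : ι →₀ ℕ) :
    monom u y α β * monom u y α' β' = monom u y (α + α') (β + β') := by
  unfold monom
  rw [Finsupp.prod_add_index' (by simp) (by intro i; exact pow_add (y i)), pow_add]
  ring

open Classical in
/-- In degrees at most `a + 2`, the functional `L` is `κ` times the functional dual to
`x ^ a * ∑ i, y i ^ 2`. -/
def IsQuadricDual (L : A →ₗ[K] K) (u : A) (y : ι → A) (a : ℕ) (κ : K) : Prop :=
  ∀ (α : ℕ) (β : ι →₀ ℕ), α + β.degree ≤ a + 2 →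
    L (monom u y α β) = if α = a ∧ ∃ i, β = Finsupp.single i 2 then κ else 0

/-- Exponents of `1`, of the square of the distinguished variable, and of the variables. -/
noncomputable def quadricExp (o : ι) : Option (Option ι) → ι →₀ ℕ
  | none => 0
  | some none => Finsupp.single o 2
  | some (some i) => Finsupp.single i 1

/-- Exponents complementary to `quadricExp`. -/
noncomputable def quadricExpDual (o : ι) : Option (Option ι) → ι →₀ ℕ
  | none => Finsupp.single o 2
  | some none => 0
  | some (some i) => Finsupp.single i 1

lemma degree_add_quadricExpDual (o : ι) (s : Option (Option ι)) :
    (quadricExp o s).degree + (quadricExpDual o s).degree = 2 := by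
  rcases s with _ | _ | i <;> simp [quadricExp, quadricExpDual, Finsupp.degree_single]

lemma single_add_single_eq_single_two {i j l : ι}
    (h : Finsupp.single i 1 + Finsupp.single j 1 = Finsupp.single l 2) : i = l ∧ j = l := by
  classical
  constructor
  · have := DFunLike.congr_fun h i
    by_contra hne
    simp [Finsupp.single_apply, Ne.symm hne] at this
  · have := DFunLike.congr_fun h j
    by_contra hne
    simp [Finsupp.single_apply, Ne.symm hne] at this

lemma quadricExp_add_dual_eq_single_iff (o : ι) (s t : Option (Option ι)) :
    (∃ i, quadricExp o s + quadricExpDual o t = Finsupp.single i 2) ↔ s = t := by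
  constructor
  · rintro ⟨l, hl⟩
    have hd := congrArg Finsupp.degree hl
    rcases s with _ | _ | i <;> rcases t with _ | _ | j <;>
      simp [quadricExp, quadricExpDual, Finsupp.degree_single] at hd hl ⊢
    obtain ⟨rfl, rfl⟩ := single_add_single_eq_single_two hl
    rfl
  · rintro rfl
    rcases s with _ | _ | i
    · exact ⟨o, by simp [quadricExp, quadricExpDual]⟩
    · exact ⟨o, by simp [quadricExp, quadricExpDual]⟩
    · exact ⟨i, by simp [quadricExp, quadricExpDual, ← Finsupp.single_add]⟩

/-- The monomials `x ^ k * s` with `k ≤ a` and `s` among `1`, `y i`, `y o ^ 2`. -/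
noncomputable def quadricBasis (u : A) (y : ι → A) (a : ℕ) (o : ι)
    (p : Fin (a + 1) × Option (Option ι)) : A :=
  monom u y p.1 (quadricExp o p.2)

/-- The degree of a member of `quadricBasis`. -/
noncomputable def quadricDeg {a : ℕ} (o : ι) (p : Fin (a + 1) × Option (Option ι)) : ℕ :=
  p.1 + (quadricExp o p.2).degree

/-- The monomials complementary to `quadricBasis`. -/
noncomputable def quadricDualBasis (u : A) (y : ι → A) (a : ℕ) (o : ι)
    (p : Fin (a + 1) × Option (Option ι)) : A :=
  monom u y (a - p.1) (quadricExpDual o p.2)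

variable {L : A →ₗ[K] K} {u : A} {y : ι → A} {a : ℕ} {κ : K}

open Classical in
lemma quadricBasis_mul_dual (hL : IsQuadricDual L u y a κ) (o : ι)
    {p q : Fin (a + 1) × Option (Option ι)} (h : quadricDeg o p ≤ quadricDeg o q) :
    L (quadricBasis u y a o p * quadricDualBasis u y a o q) =
      if p = q then κ else 0 := by
  obtain ⟨⟨k, hk⟩, s⟩ := p
  obtain ⟨⟨l, hl⟩, t⟩ := q
  have ht := degree_add_quadricExpDual o t
  simp only [quadricDeg] at h
  simp only [quadricBasis, quadricDualBasis, monom_mul]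
  rw [hL _ _ (by rw [map_add]; omega), quadricExp_add_dual_eq_single_iff]
  congr 1
  simp only [Prod.mk.injEq, Fin.mk.injEq, eq_iff_iff]
  constructor <;> rintro ⟨h1, h2⟩ <;> exact ⟨by omega, h2⟩

lemma mul_eq_monom (u : A) (y : ι → A) (i j : ι) :
    y i * y j = monom u y 0 (Finsupp.single i 1 + Finsupp.single j 1) := by
  have h : ∀ l : ι, y l = monom u y 0 (Finsupp.single l 1) := by
    intro l; simp [monom]
  rw [h i, h j, monom_mul]

lemma card_le_finrank_span_mul {J : Type*} [Finite J] [Finite ι] {y : ι → J → K}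
    (hy : LinearIndependent K y) :
    Nat.card ι ≤ Module.finrank K (Submodule.span K
      (Set.range fun p : ι × ι => y p.1 * y p.2)) := by
  classical
  cases nonempty_fintype ι
  cases nonempty_fintype J
  set w : J → ι → K := fun j i => y i j with hw
  have hspan : Submodule.span K (Set.range w) = ⊤ := by
    by_contra hne
    obtain ⟨f, hf0, hf⟩ := Submodule.exists_le_ker_of_lt_top _ (lt_top_iff_ne_top.mpr hne)
    apply hf0
    have hz : ∀ i, f (Pi.single i 1) = 0 := by
      refine Fintype.linearIndependent_iff.mp hy (fun i => f (Pi.single i 1)) ?_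
      ext j
      have h1 : f (w j) = 0 := hf (Submodule.subset_span ⟨j, rfl⟩)
      rw [pi_eq_sum_univ' (w j), map_sum] at h1
      simpa [hw, mul_comm] using h1
    ext i
    simpa using hz i
  obtain ⟨b, hb, hbs, hbl⟩ := exists_linearIndependent K (Set.range w)
  let B : Module.Basis b K (ι → K) := Module.Basis.mk hbl (by
    rw [Subtype.range_coe, hbs, hspan])
  have : Fintype b := FiniteDimensional.fintypeBasisIndex B
  have hcard : Fintype.card b = Nat.card ι := by
    rw [← Module.finrank_eq_card_basis B, Module.finrank_fintype_fun_eq_card,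
      Nat.card_eq_fintype_card]
  choose s hs using fun x : b => hb x.2
  let g : b → J → K := fun x j => B.coord x (w j) * B.coord x (w j)
  have hgs : ∀ x x' : b, g x (s x') = if x = x' then 1 else 0 := by
    intro x x'
    have h1 : w (s x') = B x' := by rw [hs, Module.Basis.mk_apply]
    simp only [g, h1, Module.Basis.coord_apply, Module.Basis.repr_self, Finsupp.single_apply]
    by_cases h : x = x'
    · simp [h]
    · simp [h, Ne.symm h]
  have hg : LinearIndependent K g := by
    rw [Fintype.linearIndependent_iff]
    intro z hz x
    have := congrFun hz (s x)
    simpa [hgs] using this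
  have hgU : ∀ x, g x ∈ Submodule.span K (Set.range fun p : ι × ι => y p.1 * y p.2) := by
    intro x
    have hc : ∀ j, B.coord x (w j) = ∑ i, B.coord x (Pi.single i 1) * y i j := by
      intro j
      conv_lhs => rw [pi_eq_sum_univ' (w j), map_sum]
      refine Finset.sum_congr rfl fun i _ => ?_
      rw [map_smul, smul_eq_mul, mul_comm]
    have hgx : g x = ∑ i, ∑ k, (B.coord x (Pi.single i 1) * B.coord x (Pi.single k 1)) •
        (y i * y k) := by
      ext j
      simp only [g, hc, Finset.sum_mul_sum, Finset.sum_apply, Pi.smul_apply, Pi.mul_apply,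
        smul_eq_mul]
      refine Finset.sum_congr rfl fun i _ => Finset.sum_congr rfl fun k _ => ?_
      ring
    rw [hgx]
    exact Submodule.sum_mem _ fun i _ => Submodule.sum_mem _ fun k _ =>
      Submodule.smul_mem _ _ (Submodule.subset_span ⟨(i, k), rfl⟩)
  rw [← hcard, ← finrank_span_eq_card hg]
  refine Submodule.finrank_mono (Submodule.span_le.mpr ?_)
  rintro _ ⟨x, rfl⟩
  exact hgU x

variable [Fintype ι]

lemma pairing_eq_mul (hL : IsQuadricDual L u y a κ) (o : ι)
    (z : Fin (a + 1) × Option (Option ι) → K) (q : Fin (a + 1) × Option (Option ι))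
    (h : ∀ p, quadricDeg o q < quadricDeg o p → z p = 0) :
    L ((∑ p, z p • quadricBasis u y a o p) * quadricDualBasis u y a o q) = z q * κ := by
  classical
  rw [Finset.sum_mul, map_sum, Finset.sum_eq_single q]
  · rw [smul_mul_assoc, map_smul, quadricBasis_mul_dual hL o le_rfl, if_pos rfl, smul_eq_mul]
  · intro p _ hp
    rw [smul_mul_assoc, map_smul]
    rcases lt_or_ge (quadricDeg o q) (quadricDeg o p) with hlt | hle
    · rw [h p hlt, zero_smul]
    · rw [quadricBasis_mul_dual hL o hle, if_neg hp, smul_zero]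
  · simp

lemma coeff_eq_zero_of_pairing (hL : IsQuadricDual L u y a κ) (hκ : κ ≠ 0) (o : ι)
    (z : Fin (a + 1) × Option (Option ι) → K) (D : ℕ)
    (h : ∀ q, D ≤ quadricDeg o q →
      L ((∑ p, z p • quadricBasis u y a o p) * quadricDualBasis u y a o q) = 0)
    (q : Fin (a + 1) × Option (Option ι)) (hq : D ≤ quadricDeg o q) : z q = 0 := by
  have hbd : ∀ p : Fin (a + 1) × Option (Option ι), quadricDeg o p ≤ a + 2 := by
    rintro ⟨⟨k, hk⟩, s⟩
    have := degree_add_quadricExpDual o s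
    simp only [quadricDeg]
    omega
  have key : ∀ N, ∀ q : Fin (a + 1) × Option (Option ι), D ≤ quadricDeg o q →
      a + 2 - quadricDeg o q = N → z q = 0 := by
    intro N
    induction N using Nat.strong_induction_on with
    | _ N ih =>
      intro q hq hN
      have h1 := pairing_eq_mul hL o z q fun p hp =>
        ih (a + 2 - quadricDeg o p) (by have := hbd p; omega) p (by omega) rfl
      rw [h q hq] at h1
      exact (mul_eq_zero.mp h1.symm).resolve_right hκ
  exact key _ q hq rfl

lemma linearIndependent_quadricBasis (hL : IsQuadricDual L u y a κ) (hκ : κ ≠ 0) (o : ι) :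
    LinearIndependent K (quadricBasis u y a o) := by
  rw [Fintype.linearIndependent_iff]
  intro z hz q
  exact coeff_eq_zero_of_pairing hL hκ o z 0 (by simp [hz]) q (Nat.zero_le _)

/-- The quadratic form in the `y i` with coefficients `c`. -/
def quadraticForm (c : ι × ι → K) (y : ι → A) : A :=
  ∑ p : ι × ι, c p • (y p.1 * y p.2)

lemma quadraticForm_mul_monom (c : ι × ι → K) (α : ℕ) (β : ι →₀ ℕ) :
    L (quadraticForm c y * monom u y α β) = ∑ p : ι × ι, c p *
      L (monom u y α (Finsupp.single p.1 1 + Finsupp.single p.2 1 + β)) := by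
  simp only [quadraticForm, Finset.sum_mul, map_sum, smul_mul_assoc, map_smul,
    mul_eq_monom u y, monom_mul, zero_add, smul_eq_mul]

lemma quadraticForm_mul_monom_eq_zero (hL : IsQuadricDual L u y a κ) (c : ι × ι → K)
    (α : ℕ) (β : ι →₀ ℕ) (hα : α ≠ a) (h : α + β.degree ≤ a) :
    L (quadraticForm c y * monom u y α β) = 0 := by
  rw [quadraticForm_mul_monom]
  refine Finset.sum_eq_zero fun p _ => ?_
  rw [hL _ _ (by simp only [map_add, Finsupp.degree_single]; omega), if_neg (by tauto), mul_zero]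

/-- In degree `a + 3`, the functional `L` is a multiple of the evaluation at a point. -/
def IsTopEval (L : A →ₗ[K] K) (u : A) (y : ι → A) (a : ℕ) (γ v₀ : K) (v : ι → K) : Prop :=
  ∀ (α : ℕ) (β : ι →₀ ℕ), α + β.degree = a + 3 →
    L (monom u y α β) = γ * monom v₀ v α β

lemma quadraticForm_mul_top {γ v₀ : K} {v : ι → K} (hT : IsTopEval L u y a γ v₀ v)
    (c : ι × ι → K) (α : ℕ) (β : ι →₀ ℕ) (h : α + β.degree = a + 1) :
    L (quadraticForm c y * monom u y α β) = γ * quadraticForm c v * monom v₀ v α β := by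
  rw [quadraticForm_mul_monom, quadraticForm, Finset.mul_sum, Finset.sum_mul]
  refine Finset.sum_congr rfl fun p _ => ?_
  rw [hT _ _ (by simp only [map_add, Finsupp.degree_single]; omega),
    mul_eq_monom v₀ v, smul_eq_mul]
  have := monom_mul v₀ v 0 α (Finsupp.single p.1 1 + Finsupp.single p.2 1) β
  rw [zero_add] at this
  rw [← this]
  ring


lemma coeff_eq_zero_of_quadraticForm_eq (hL : IsQuadricDual L u y a κ) (hκ : κ ≠ 0)
    (ha : 2 ≤ a) {γ v₀ : K} {v : ι → K} (hT : IsTopEval L u y a γ v₀ v) (o : ι)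
    (c : ι × ι → K) (z : Fin (a + 1) × Option (Option ι) → K)
    (hf : quadraticForm c y = ∑ p, z p • quadricBasis u y a o p)
    (q : Fin (a + 1) × Option (Option ι)) (h0 : q ≠ (0, none)) (h2 : q ≠ (0, some none)) :
    z q = 0 := by
  classical
  have hv : ((1 : Fin (a + 1)) : ℕ) = 1 := by
    rw [Fin.coe_ofNat_eq_mod, Nat.mod_eq_of_lt (by omega)]
  have hbig : ∀ q : Fin (a + 1) × Option (Option ι), 3 ≤ quadricDeg o q → z q = 0 := by
    refine coeff_eq_zero_of_pairing hL hκ o z 3 ?_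
    rintro ⟨⟨k, hk⟩, s⟩ hq
    have := degree_add_quadricExpDual o s
    simp only [quadricDeg] at hq
    rw [← hf]
    exact quadraticForm_mul_monom_eq_zero hL c _ _ (by simp only; omega) (by simp only; omega)
  have hmid : ∀ q : Fin (a + 1) × Option (Option ι), 2 ≤ quadricDeg o q → q.1 ≠ 0 →
      z q = 0 := by
    rintro ⟨⟨k, hk⟩, s⟩ hq hk0
    rcases hq.lt_or_eq with hq' | hq'
    · exact hbig _ hq'
    have hk1 : k ≠ 0 := fun h => hk0 (by ext; simpa using h)
    have h1 := pairing_eq_mul hL o z (⟨k, hk⟩, s) fun p hp => hbig p (by omega)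
    have := degree_add_quadricExpDual o s
    simp only [quadricDeg] at hq
    rw [← hf, quadricDualBasis, quadraticForm_mul_monom_eq_zero hL c _ _
      (by simp only; omega) (by simp only; omega)] at h1
    exact (mul_eq_zero.mp h1.symm).resolve_right hκ
  obtain ⟨T, hTT⟩ : ∃ T : K, ∀ (α : ℕ) (β : ι →₀ ℕ), α + β.degree = a + 1 →
      T * monom v₀ v α β = ∑ p ∈ Finset.univ.erase (0, some none),
        z p * L (quadricBasis u y a o p * monom u y α β) := by
    refine ⟨γ * (quadraticForm c v - z (0, some none) *
      monom v₀ v 0 (Finsupp.single o 2)), fun α β h => ?_⟩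
    have e1 := quadraticForm_mul_top hT c α β h
    rw [hf, Finset.sum_mul, map_sum,
      ← Finset.add_sum_erase _ _ (Finset.mem_univ (0, some none))] at e1
    simp only [smul_mul_assoc, map_smul, smul_eq_mul] at e1
    have e2 : L (quadricBasis u y a o (0, some none) * monom u y α β) =
        γ * (monom v₀ v 0 (Finsupp.single o 2) * monom v₀ v α β) := by
      rw [quadricBasis, monom_mul, monom_mul, hT]
      · simp [quadricExp]
      · simp only [quadricExp, map_add, Finsupp.degree_single, Fin.val_zero]; omega
    rw [e2] at e1
    linear_combination -e1
  have hterm : ∀ (α : ℕ) (β : ι →₀ ℕ), α + β.degree = a + 1 →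
      ∀ p ∈ Finset.univ.erase ((0, some none) : Fin (a + 1) × Option (Option ι)),
      z p * L (quadricBasis u y a o p * monom u y α β) ≠ 0 →
      (p = (1, none) ∧ α + 1 = a) ∨ (∃ i l, p = (0, some (some i)) ∧ α = a ∧
        Finsupp.single i 1 + β = Finsupp.single l 2) := by
    rintro α β h ⟨k, s⟩ hp hne
    have hp' := Finset.ne_of_mem_erase hp
    have hz := left_ne_zero_of_mul hne
    have hl := right_ne_zero_of_mul hne
    have hd : quadricDeg o (k, s) ≤ 1 := by
      by_contra hd
      have hk : k = 0 := by
        by_contra hk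
        exact hz (hmid _ (by omega) hk)
      subst hk
      rcases s with _ | _ | i
      · simp [quadricDeg, quadricExp] at hd
      · exact hp' rfl
      · simp [quadricDeg, quadricExp, Finsupp.degree_single] at hd
    simp only [quadricDeg] at hd
    rw [quadricBasis, monom_mul, hL _ _ (by simp only [map_add]; omega)] at hl
    simp only [ne_eq, ite_eq_right_iff, not_forall] at hl
    obtain ⟨⟨h3, l, h4⟩, -⟩ := hl
    have h5 := congrArg Finsupp.degree h4
    rw [map_add, Finsupp.degree_single] at h5
    rcases s with _ | _ | i
    · left
      simp only [quadricExp, map_zero] at h5 hd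
      have : k = 1 := by
        ext
        rw [hv]
        omega
      subst this
      rw [hv] at h3
      exact ⟨rfl, by omega⟩
    · simp [quadricExp, Finsupp.degree_single] at hd
    · right
      simp only [quadricExp, Finsupp.degree_single] at h5 hd h4
      have : k = 0 := by ext; simp only [Fin.val_zero]; omega
      subst this
      exact ⟨i, l, rfl, by simpa using h3, h4⟩
  have hT0 : T * v₀ = 0 := by
    have h1 := hTT (a + 1) 0 (by simp)
    rw [Finset.sum_eq_zero] at h1
    · simp only [monom, Finsupp.prod_zero_index, mul_one] at h1
      rcases mul_eq_zero.mp h1 with h | h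
      · simp [h]
      · simp [eq_zero_of_pow_eq_zero h]
    · intro p hp
      by_contra hne
      rcases hterm (a + 1) 0 (by simp) p hp hne with ⟨-, h⟩ | ⟨i, l, -, h, -⟩ <;> omega
  have hsum : ∀ (α : ℕ) (β : ι →₀ ℕ), α + β.degree = a + 1 → 1 ≤ α →
      ∑ p ∈ Finset.univ.erase (0, some none),
        z p * L (quadricBasis u y a o p * monom u y α β) = 0 := by
    intro α β h hα
    obtain ⟨α, rfl⟩ := Nat.exists_eq_add_of_le' hα
    rw [← hTT _ _ h, monom, pow_succ]
    linear_combination (v₀ ^ α * β.prod fun i e => v i ^ e) * hT0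
  have hlin : ∀ i, z (0, some (some i)) = 0 := by
    intro i
    have h1 := hsum a (Finsupp.single i 1) (by simp [Finsupp.degree_single]) (by omega)
    rw [Finset.sum_eq_single_of_mem (0, some (some i)) (by simp)] at h1
    · rw [quadricBasis, monom_mul, hL _ _ (by
        simp only [quadricExp, map_add, Finsupp.degree_single, Fin.val_zero]; omega), if_pos] at h1
      · exact (mul_eq_zero.mp h1).resolve_right hκ
      · exact ⟨by simp, i, by simp [quadricExp, ← Finsupp.single_add]⟩
    · intro p hp hpi
      by_contra hne
      rcases hterm a _ (by simp [Finsupp.degree_single]) p hp hne with ⟨-, h⟩ | ⟨j, l, h, -, h'⟩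
      · omega
      · obtain ⟨rfl, rfl⟩ := single_add_single_eq_single_two h'
        exact hpi h
  have hone : z (1, none) = 0 := by
    have hdeg : a - 1 + (Finsupp.single o 2).degree = a + 1 := by
      rw [Finsupp.degree_single]; omega
    have h1 := hsum (a - 1) (Finsupp.single o 2) hdeg (by omega)
    rw [Finset.sum_eq_single_of_mem (1, none) (by simp)] at h1
    · rw [quadricBasis, monom_mul, hL _ _ (by
        simp only [quadricExp, map_add, Finsupp.degree_single, map_zero]; omega), if_pos] at h1
      · exact (mul_eq_zero.mp h1).resolve_right hκ
      · exact ⟨by simp only [hv]; omega, o, by simp [quadricExp]⟩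
    · intro p hp hpi
      by_contra hne
      rcases hterm _ _ hdeg p hp hne with ⟨h, -⟩ | ⟨j, l, -, h, -⟩
      · exact hpi h
      · omega
  by_cases hd : 2 ≤ quadricDeg o q
  · refine hmid q hd fun hk => ?_
    obtain ⟨k, s⟩ := q
    simp only at hk
    subst hk
    rcases s with _ | _ | i
    · exact h0 rfl
    · exact h2 rfl
    · simp [quadricDeg, quadricExp, Finsupp.degree_single] at hd
  · obtain ⟨k, s⟩ := q
    simp only [quadricDeg] at hd
    rcases s with _ | _ | i
    · simp only [quadricExp, map_zero] at hd
      have hk : (k : ℕ) ≠ 0 := fun hk => h0 (by congr 1; ext; simpa using hk)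
      have : k = 1 := by
        ext
        rw [hv]
        omega
      rw [this, hone]
    · simp [quadricExp, Finsupp.degree_single] at hd
    · simp only [quadricExp, Finsupp.degree_single] at hd
      have : k = 0 := by ext; simp only [Fin.val_zero]; omega
      rw [this, hlin]

lemma le_card_of_isQuadricDual {J : Type*} [Fintype J] {L : (J → K) →ₗ[K] K} {u : J → K}
    {y : ι → J → K} (hL : IsQuadricDual L u y a κ) (hκ : κ ≠ 0) [Nonempty ι] :
    (a + 1) * (Fintype.card ι + 2) ≤ Fintype.card J := by
  have h := (linearIndependent_quadricBasis hL hκ (Classical.arbitrary ι)).fintype_card_le_finrank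
  simpa [add_assoc] using h

lemma lt_card_of_isQuadricDual_of_isTopEval {J : Type*} [Fintype J] {L : (J → K) →ₗ[K] K}
    {u : J → K} {y : ι → J → K} (hL : IsQuadricDual L u y a κ) (hκ : κ ≠ 0) (ha : 2 ≤ a)
    {γ v₀ : K} {v : ι → K} (hT : IsTopEval L u y a γ v₀ v) (hι : 4 ≤ Fintype.card ι) :
    (a + 1) * (Fintype.card ι + 2) + 2 ≤ Fintype.card J := by
  classical
  have : Nonempty ι := Fintype.card_pos_iff.mp (by omega)
  let o : ι := Classical.arbitrary ι
  have hlin := linearIndependent_quadricBasis hL hκ o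
  have hy : LinearIndependent K y := by
    have h := hlin.comp (fun i => ((0 : Fin (a + 1)), some (some i)))
      fun i j h => by simpa using h
    have hfun : y = quadricBasis u y a o ∘ fun i => ((0 : Fin (a + 1)), some (some i)) := by
      ext i j
      simp [quadricBasis, quadricExp, monom]
    rw [hfun]
    exact h
  have hU := card_le_finrank_span_mul hy
  have hP := finrank_span_eq_card hlin
  set U := Submodule.span K (Set.range fun p : ι × ι => y p.1 * y p.2) with hUdef
  set P := Submodule.span K (Set.range (quadricBasis u y a o)) with hPdef
  have hinf : U ⊓ P ≤ Submodule.span K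
      (({quadricBasis u y a o (0, none), quadricBasis u y a o (0, some none)} :
        Finset (J → K)) : Set (J → K)) := by
    rintro f ⟨hfU, hfP⟩
    obtain ⟨c, hc⟩ := (Submodule.mem_span_range_iff_exists_fun K).mp hfU
    obtain ⟨z, hz⟩ := (Submodule.mem_span_range_iff_exists_fun K).mp hfP
    rw [← hz]
    refine Submodule.sum_mem _ fun p _ => ?_
    by_cases h0 : p = (0, none)
    · subst h0
      exact Submodule.smul_mem _ _ (Submodule.subset_span (by simp))
    by_cases h2 : p = (0, some none)
    · subst h2
      exact Submodule.smul_mem _ _ (Submodule.subset_span (by simp))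
    rw [coeff_eq_zero_of_quadraticForm_eq hL hκ ha hT o c z (hc.trans hz.symm) p h0 h2,
      zero_smul]
    exact Submodule.zero_mem _
  have h1 := (Submodule.finrank_mono hinf).trans
    ((finrank_span_finset_le_card _).trans Finset.card_le_two)
  have h2 := Submodule.finrank_sup_add_finrank_inf_eq U P
  have h3 : Module.finrank K ↥(U ⊔ P) ≤ Fintype.card J := by
    simpa using Submodule.finrank_le (U ⊔ P)
  simp only [Fintype.card_prod, Fintype.card_fin, Fintype.card_option] at hP
  rw [Nat.card_eq_fintype_card] at hU
  rw [show Fintype.card ι + 2 = Fintype.card ι + 1 + 1 from rfl]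
  omega

end Moments

section Lower

variable {K : Type*} [Field K]

lemma monom_smul {ι : Type*} (t u : K) (y : ι → K) (α : ℕ) (β : ι →₀ ℕ) :
    monom (t * u) (fun i => t * y i) α β = t ^ (α + β.degree) * monom u y α β := by
  have : (β.prod fun i e => (t * y i) ^ e) = t ^ β.degree * β.prod fun i e => y i ^ e := by
    simp only [Finsupp.prod, Finsupp.degree_apply, mul_pow, Finset.prod_mul_distrib,
      Finset.prod_pow_eq_pow_sum]
  rw [monom, this, monom, mul_pow, pow_add]
  ring

lemma monom_apply {ι J : Type*} (u : J → K) (y : ι → J → K) (α : ℕ) (β : ι →₀ ℕ) (j : J) :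
    monom u y α β j = monom (u j) (fun i => y i j) α β := by
  simp [monom, Finsupp.prod, Finset.prod_apply]

/-- Comparing coefficients in a Waring decomposition. -/
lemma IsWaringDecomp.exists_moments {m d r : ℕ} {F : MvPolynomial (Fin m) K}
    (h : IsWaringDecomp F d r) :
    ∃ (c : Fin r → K) (A : Fin r → Fin m → K), ∀ s : Fin m →₀ ℕ, s.degree = d →
      (d.factorial : K) * ∑ j, c j * ∏ i, A j i ^ s i =
        (∏ i, ((s i).factorial : K)) * coeff s F := by
  obtain ⟨ℓ, hℓ, hF⟩ := h
  obtain ⟨c, hc⟩ := (Submodule.mem_span_range_iff_exists_fun K).mp hF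
  have hA : ∀ j, ∃ A : Fin m →₀ K, Finsupp.linearCombination K X A = ℓ j := by
    intro j
    have h1 := (mem_homogeneousSubmodule 1 (ℓ j)).mpr (hℓ j)
    rw [homogeneousSubmodule_one_eq_span_X] at h1
    exact (Finsupp.mem_span_range_iff_exists_finsupp).mp h1
  choose A hA using hA
  refine ⟨c, fun j i => A j i, fun s hs => ?_⟩
  have hs' : (s.sum fun _ e => e) = d := by rw [← hs, Finsupp.degree_apply, Finsupp.sum]
  have hfac : (∏ i, ((s i).factorial : K)) * (s.multinomial : K) = d.factorial := by
    have h1 := Nat.multinomial_spec Finset.univ s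
    rw [Finsupp.multinomial_of_support_subset (Finset.subset_univ _)] at h1
    rw [Finsupp.degree_eq_sum] at hs
    rw [hs] at h1
    rw [← h1]
    push_cast
    rfl
  rw [← hc, coeff_sum, ← hfac, mul_assoc, Finset.mul_sum]
  congr 1
  refine Finset.sum_congr rfl fun j _ => ?_
  rw [coeff_smul, ← hA, coeff_linearCombination_X_pow, if_pos hs', smul_eq_mul,
    Finsupp.prod_fintype _ _ (by simp)]
  ring

/-- The form `x₀ ^ a * x₁ * (x₂ ^ 2 + ⋯)`. -/
noncomputable def quadricCone (K : Type*) [Field K] (a : ℕ) : MvPolynomial (Fin (a + 4)) K :=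
  ∑ i : Fin (a + 2), X 0 ^ a * X 1 * X i.succ.succ ^ 2

lemma degree_cons {m : ℕ} (k : ℕ) (β : Fin m →₀ ℕ) :
    (Finsupp.cons k β).degree = k + β.degree := by
  simp [Finsupp.degree_eq_sum, Fin.sum_univ_succ]

lemma cons_cons_one {m : ℕ} (α k : ℕ) (β : Fin m →₀ ℕ) :
    (Finsupp.cons α (Finsupp.cons k β) : Fin (m + 2) →₀ ℕ) 1 = k := rfl

open Classical in
lemma coeff_quadricCone (a α k : ℕ) (β : Fin (a + 2) →₀ ℕ) :
    coeff (Finsupp.cons α (Finsupp.cons k β)) (quadricCone K a) =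
      if α = a ∧ k = 1 ∧ ∃ i, β = Finsupp.single i 2 then 1 else 0 := by
  have hmon : ∀ i : Fin (a + 2), (X 0 ^ a * X 1 * X i.succ.succ ^ 2 :
      MvPolynomial (Fin (a + 4)) K) =
      monomial (Finsupp.cons a (Finsupp.cons 1 (Finsupp.single i 2))) 1 := by
    intro i
    rw [monomial_eq, Finsupp.prod_fintype _ _ (by simp), Fin.prod_univ_succ, Fin.prod_univ_succ,
      Finset.prod_eq_single i]
    · simp [mul_assoc, cons_cons_one]
    · intro b _ hb
      simp [Ne.symm hb]
    · simp
  have hinj : ∀ i : Fin (a + 2), (Finsupp.cons a (Finsupp.cons 1 (Finsupp.single i 2)) =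
      Finsupp.cons α (Finsupp.cons k β)) ↔ (α = a ∧ k = 1 ∧ β = Finsupp.single i 2) := by
    intro i
    rw [Finsupp.cons_injective2.eq_iff, Finsupp.cons_injective2.eq_iff]
    tauto
  simp only [quadricCone, coeff_sum, hmon, coeff_monomial, hinj]
  split_ifs with h
  · obtain ⟨h1, h2, i, rfl⟩ := h
    rw [Finset.sum_eq_single i] <;> simp_all [Finsupp.single_left_inj, eq_comm]
  · refine Finset.sum_eq_zero fun i _ => if_neg fun hi => h ⟨hi.1, hi.2.1, i, hi.2.2⟩

lemma prod_pow_cons_cons {a : ℕ} (A : Fin (a + 4) → K) (α k : ℕ) (β : Fin (a + 2) →₀ ℕ) :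
    ∏ i, A i ^ (Finsupp.cons α (Finsupp.cons k β) : Fin (a + 4) →₀ ℕ) i =
      A 1 ^ k * monom (A 0) (fun i : Fin (a + 2) => A i.succ.succ) α β := by
  rw [Fin.prod_univ_succ, Fin.prod_univ_succ, monom, Finsupp.prod_fintype _ _ (by simp)]
  simp [cons_cons_one]
  ring

theorem le_of_isWaringDecomp_quadricCone [CharZero K] {a r : ℕ} (ha : 2 ≤ a)
    (h : IsWaringDecomp (quadricCone K a) (a + 3) r) : (a + 3) * (a + 2) ≤ r := by
  classical
  obtain ⟨c, A, hcA⟩ := h.exists_moments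
  set κ : K := a.factorial * 2 / (a + 3).factorial with hκdef
  have hfac : ((a + 3).factorial : K) ≠ 0 := by exact_mod_cast (a + 3).factorial_ne_zero
  have hκ : κ ≠ 0 := by
    have : (a.factorial : K) ≠ 0 := by exact_mod_cast a.factorial_ne_zero
    exact div_ne_zero (mul_ne_zero this two_ne_zero) hfac
  have hmom : ∀ (α k : ℕ) (β : Fin (a + 2) →₀ ℕ), α + (k + β.degree) = a + 3 →
      ∑ j, c j * (A j 1 ^ k * monom (A j 0) (fun i : Fin (a + 2) => A j i.succ.succ) α β) =
        if α = a ∧ k = 1 ∧ ∃ i, β = Finsupp.single i 2 then κ else 0 := by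
    intro α k β hd
    have h1 := hcA (Finsupp.cons α (Finsupp.cons k β)) (by rw [degree_cons, degree_cons, hd])
    simp only [prod_pow_cons_cons] at h1
    rw [coeff_quadricCone] at h1
    split_ifs at h1 ⊢ with hc
    · obtain ⟨rfl, rfl, i, rfl⟩ := hc
      rw [Fin.prod_univ_succ, Fin.prod_univ_succ, Finset.prod_eq_single i] at h1
      · rw [hκdef, eq_div_iff hfac, mul_comm, h1]
        simp [cons_cons_one]
      · intro b _ hb
        simp [Ne.symm hb]
      · simp
    · rw [mul_zero] at h1
      exact (mul_eq_zero.mp h1).resolve_left hfac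
  let J := {j : Fin r // A j 1 ≠ 0}
  let L : (J → K) →ₗ[K] K :=
    ∑ j : J, (c j * A j 1 ^ (a + 3)) • LinearMap.proj j
  let u : J → K := fun j => A j 0 / A j 1
  let y : Fin (a + 2) → J → K := fun i j => A j i.succ.succ / A j 1
  have hLm : ∀ (α k : ℕ) (β : Fin (a + 2) →₀ ℕ), α + (k + β.degree) = a + 3 →
      L (monom u y α β) = ∑ j : J, c j * (A j 1 ^ k *
        monom (A j 0) (fun i : Fin (a + 2) => A j i.succ.succ) α β) := by
    intro α k β hd
    simp only [L, LinearMap.sum_apply, LinearMap.smul_apply, LinearMap.proj_apply, smul_eq_mul,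
      monom_apply]
    refine Finset.sum_congr rfl fun j _ => ?_
    have hj : A j 1 ≠ 0 := j.2
    have h1 := monom_smul (A j 1) (u j) (fun i => y i j) α β
    simp only [u, y, mul_div_cancel₀ _ hj] at h1 ⊢
    have hpow : A j 1 ^ (a + 3) = A j 1 ^ k * A j 1 ^ (α + β.degree) := by
      rw [← pow_add]
      congr 1
      omega
    rw [h1, hpow]
    ring
  have hsplit : ∀ f : Fin r → K, ∑ j : J, f j + ∑ j : {j // ¬ A j 1 ≠ 0}, f j = ∑ j, f j :=
    fun f => Fintype.sum_subtype_add_sum_subtype (fun j => A j 1 ≠ 0) f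
  have hL : IsQuadricDual L u y a κ := by
    intro α β hd
    obtain ⟨k, hk⟩ := Nat.exists_eq_add_of_le hd
    have hd' : α + (k + 1 + β.degree) = a + 3 := by omega
    rw [hLm α (k + 1) β hd']
    have h1 := hsplit fun j => c j * (A j 1 ^ (k + 1) *
        monom (A j 0) (fun i : Fin (a + 2) => A j i.succ.succ) α β)
    rw [hmom α (k + 1) β hd', Finset.sum_eq_zero (s := Finset.univ) (ι := {j // ¬ A j 1 ≠ 0}),
      add_zero] at h1
    · rw [h1]
      have hiff : (α = a ∧ k + 1 = 1 ∧ ∃ i, β = Finsupp.single i 2) ↔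
          (α = a ∧ ∃ i, β = Finsupp.single i 2) := by
        constructor
        · rintro ⟨h1, -, h2⟩
          exact ⟨h1, h2⟩
        · rintro ⟨rfl, i, rfl⟩
          rw [Finsupp.degree_single] at hk
          exact ⟨rfl, by omega, i, rfl⟩
      by_cases hc : α = a ∧ ∃ i, β = Finsupp.single i 2
      · rw [if_pos hc, if_pos (hiff.mpr hc)]
      · rw [if_neg hc, if_neg (hiff.not.mpr hc)]
    · rintro ⟨j, hj⟩ -
      simp [not_not.mp hj]
  by_contra hlt
  have hJ := le_card_of_isQuadricDual hL hκ
  have hcompl := Fintype.card_subtype_compl (fun j : Fin r => A j 1 ≠ 0)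
  have hJr : Fintype.card J ≤ r := by
    have h1 := Fintype.card_subtype_le fun j : Fin r => A j 1 ≠ 0
    rwa [Fintype.card_fin] at h1
  simp only [Fintype.card_fin] at hcompl hJ
  have hr : (a + 3) * (a + 2) = (a + 1) * (a + 2 + 2) + 2 := by ring
  obtain ⟨γ, v₀, v, hT⟩ : ∃ (γ v₀ : K) (v : Fin (a + 2) → K), IsTopEval L u y a γ v₀ v := by
    have hsum : ∀ (α : ℕ) (β : Fin (a + 2) →₀ ℕ), α + β.degree = a + 3 →
        L (monom u y α β) = - ∑ j : {j // ¬ A j 1 ≠ 0}, c j *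
          monom (A j 0) (fun i : Fin (a + 2) => A j i.succ.succ) α β := by
      intro α β hd
      have h1 := hsplit fun j => c j * (A j 1 ^ 0 *
          monom (A j 0) (fun i : Fin (a + 2) => A j i.succ.succ) α β)
      rw [← hLm α 0 β (by omega), hmom α 0 β (by omega), if_neg (by simp)] at h1
      simpa using eq_neg_of_add_eq_zero_left h1
    have hsub : Subsingleton {j // ¬ A j 1 ≠ 0} := by
      rw [← Fintype.card_le_one_iff_subsingleton, hcompl]
      change r - Fintype.card J ≤ 1
      omega
    rcases isEmpty_or_nonempty {j // ¬ A j 1 ≠ 0} with he | ⟨⟨j₀⟩⟩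
    · exact ⟨0, 0, 0, fun α β hd => by rw [hsum α β hd]; simp⟩
    · refine ⟨- c j₀, A j₀ 0, fun i => A j₀ i.succ.succ, fun α β hd => ?_⟩
      rw [hsum α β hd, Fintype.sum_subsingleton _ j₀, neg_mul]
  have := lt_card_of_isQuadricDual_of_isTopEval hL hκ ha hT (by simp; omega)
  simp only [Fintype.card_fin] at this
  omega

end Lower

section Upper

variable {K : Type*} [Field K]

lemma IsWaringDecomp.of_fintype {T : Type*} [Fintype T] {m d r : ℕ}
    {F : MvPolynomial (Fin m) K} (hr : Fintype.card T ≤ r) (ℓ : T → MvPolynomial (Fin m) K)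
    (hℓ : ∀ t, (ℓ t).IsHomogeneous 1) (hF : F ∈ Submodule.span K (Set.range fun t => ℓ t ^ d)) :
    IsWaringDecomp F d r := by
  classical
  let e : T ↪ Fin r := (Fintype.equivFin T).toEmbedding.trans (Fin.castLEEmb hr)
  refine ⟨Function.extend e ℓ 0, fun j => ?_, Submodule.span_mono ?_ hF⟩
  · by_cases hj : ∃ t, e t = j
    · obtain ⟨t, rfl⟩ := hj
      rw [e.injective.extend_apply]
      exact hℓ t
    · rw [Function.extend_apply' _ _ _ hj]
      exact isHomogeneous_zero _ _ _
  · rintro _ ⟨t, rfl⟩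
    exact ⟨e t, by simp only [e.injective.extend_apply]⟩

lemma IsPrimitiveRoot.sum_pow_mul_eq_ite {N : ℕ} {ω : K} (hω : IsPrimitiveRoot ω N) (k : ℕ) :
    ∑ t ∈ Finset.range N, ω ^ t * (ω ^ t) ^ k = if N ∣ k + 1 then (N : K) else 0 := by
  have h1 : ∀ t, ω ^ t * (ω ^ t) ^ k = (ω ^ (k + 1)) ^ t := fun t => by
    rw [← pow_succ', ← pow_mul, ← pow_mul, mul_comm]
  simp only [h1]
  split_ifs with h
  · simp [(hω.pow_eq_one_iff_dvd _).mpr h]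
  · have hne : ω ^ (k + 1) ≠ 1 := fun h' => h ((hω.pow_eq_one_iff_dvd _).mp h')
    have h2 := geom_sum_mul (ω ^ (k + 1)) N
    rw [← pow_mul, mul_comm (k + 1), pow_mul, hω.pow_eq_one, one_pow, sub_self] at h2
    exact (mul_eq_zero.mp h2).resolve_right (sub_ne_zero.mpr hne)

variable {R : Type*} [CommRing R] [Algebra K R]

lemma IsPrimitiveRoot.sum_smul_add_pow {N : ℕ} {ω : K} (hω : IsPrimitiveRoot ω N) (n : ℕ)
    (x p : R) :
    ∑ t ∈ Finset.range N, ω ^ t • (ω ^ t • x + p) ^ n =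
      ∑ k ∈ Finset.range (n + 1), (if N ∣ k + 1 then (N : K) else 0) •
        (x ^ k * p ^ (n - k) * (n.choose k : R)) := by
  simp only [add_pow, Finset.smul_sum]
  rw [Finset.sum_comm]
  refine Finset.sum_congr rfl fun k _ => ?_
  rw [← hω.sum_pow_mul_eq_ite, Finset.sum_smul]
  refine Finset.sum_congr rfl fun t _ => ?_
  rw [_root_.smul_pow, smul_mul_assoc, smul_mul_assoc, smul_smul]

lemma IsPrimitiveRoot.sum_smul_cubic_difference {a : ℕ} (ha : 2 ≤ a) {ω : K}
    (hω : IsPrimitiveRoot ω (a + 1)) (x p q : R) :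
    ∑ t ∈ Finset.range (a + 1), ω ^ t • ((ω ^ t • x + (p + q)) ^ (a + 3) +
      (ω ^ t • x + (p - q)) ^ (a + 3) - (2 : K) • (ω ^ t • x + p) ^ (a + 3)) =
      ((a + 1 : ℕ) * ((a + 3).choose a : K) * 6) • (x ^ a * p * q ^ 2) := by
  have h1 : ∀ t : ℕ, ω ^ t • ((ω ^ t • x + (p + q)) ^ (a + 3) +
      (ω ^ t • x + (p - q)) ^ (a + 3) - (2 : K) • (ω ^ t • x + p) ^ (a + 3)) =
      ω ^ t • (ω ^ t • x + (p + q)) ^ (a + 3) + ω ^ t • (ω ^ t • x + (p - q)) ^ (a + 3) -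
      (2 : K) • ω ^ t • (ω ^ t • x + p) ^ (a + 3) := fun t => by
    rw [smul_sub, smul_add, smul_comm (2 : K)]
  simp only [h1]
  rw [Finset.sum_sub_distrib, Finset.sum_add_distrib, ← Finset.smul_sum,
    hω.sum_smul_add_pow, hω.sum_smul_add_pow, hω.sum_smul_add_pow, Finset.smul_sum,
    ← Finset.sum_add_distrib, ← Finset.sum_sub_distrib, Finset.sum_eq_single a]
  · simp only [dvd_refl, if_true, Nat.add_sub_cancel_left, Algebra.smul_def, map_mul, map_ofNat,
      map_natCast]
    ring
  · intro k hk hne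
    rw [Finset.mem_range] at hk
    split_ifs with hd
    · obtain ⟨e, he⟩ := hd
      have he2 : e = 2 := by
        rcases e with _ | _ | _ | e
        · omega
        · omega
        · rfl
        · nlinarith
      subst he2
      have hk' : a + 3 - k = 0 := by omega
      simp only [hk', pow_zero, Algebra.smul_def, map_ofNat, map_natCast]
      ring
    · simp
  · simp

theorem isWaringDecomp_quadricCone [IsAlgClosed K] [CharZero K] {a r : ℕ} (ha : 2 ≤ a)
    (hr : (a + 1) * (2 * (a + 2) + 1) ≤ r) :
    IsWaringDecomp (quadricCone K a) (a + 3) r := by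
  obtain ⟨ω, hω⟩ := HasEnoughRootsOfUnity.exists_primitiveRoot K (a + 1)
  let g : Option (Fin (a + 2) × Bool) → MvPolynomial (Fin (a + 4)) K
    | none => X 1
    | some (i, true) => X 1 + X i.succ.succ
    | some (i, false) => X 1 - X i.succ.succ
  have hg : ∀ s, (g s).IsHomogeneous 1 := by
    rintro (_ | ⟨i, _ | _⟩)
    · exact isHomogeneous_X _ _
    · exact (isHomogeneous_X _ _).sub (isHomogeneous_X _ _)
    · exact (isHomogeneous_X _ _).add (isHomogeneous_X _ _)
  let ℓ : Fin (a + 1) × Option (Fin (a + 2) × Bool) → MvPolynomial (Fin (a + 4)) K :=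
    fun t => ω ^ (t.1 : ℕ) • X 0 + g t.2
  refine IsWaringDecomp.of_fintype (T := Fin (a + 1) × Option (Fin (a + 2) × Bool)) ?_ ℓ ?_ ?_
  · simp only [Fintype.card_prod, Fintype.card_fin, Fintype.card_option, Fintype.card_bool]
    linarith
  · intro t
    refine IsHomogeneous.add ?_ (hg _)
    rw [smul_eq_C_mul]
    exact (isHomogeneous_X _ _).C_mul _
  · have hmem : ∀ (t : ℕ) (s), t ∈ Finset.range (a + 1) →
        (ω ^ t • X 0 + g s) ^ (a + 3) ∈ Submodule.span K (Set.range fun t => ℓ t ^ (a + 3)) :=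
      fun t s ht => Submodule.subset_span ⟨(⟨t, Finset.mem_range.mp ht⟩, s), rfl⟩
    refine Submodule.sum_mem _ fun i _ => ?_
    have hc : (((a + 1 : ℕ) : K) * ((a + 3).choose a : K) * 6) ≠ 0 := by
      have h1 : ((a + 3).choose a : K) ≠ 0 := by
        exact_mod_cast (Nat.choose_pos (by omega)).ne'
      have h2 : ((a + 1 : ℕ) : K) ≠ 0 := by exact_mod_cast a.succ_ne_zero
      exact mul_ne_zero (mul_ne_zero h2 h1) (by norm_num)
    rw [← Submodule.smul_mem_iff _ hc, ← hω.sum_smul_cubic_difference ha]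
    refine Submodule.sum_mem _ fun t ht => Submodule.smul_mem _ _ ?_
    exact Submodule.sub_mem _ (Submodule.add_mem _ (hmem t (some (i, true)) ht)
      (hmem t (some (i, false)) ht)) (Submodule.smul_mem _ _ (hmem t none ht))

end Upper

/-- For `n ≥ 5`, the degree-`n` form
`F = x₀^{n−3}x₁·(x₂² + ⋯ + x_n²)` satisfies `n(n−1) ≤ rk(F) ≤ 2n(n−2)`. -/
theorem stmt12 (K : Type*) [Field K] [IsAlgClosed K] [CharZero K] (n : ℕ) (hn : 5 ≤ n) :
    n * (n - 1) ≤
      waringRank ((X 0) ^ (n - 3) * X 1 *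
        (∑ i ∈ Finset.univ.filter (fun i : Fin (n + 1) => 2 ≤ (i : ℕ)), X i ^ 2) :
        MvPolynomial (Fin (n + 1)) K) n ∧
    waringRank ((X 0) ^ (n - 3) * X 1 *
        (∑ i ∈ Finset.univ.filter (fun i : Fin (n + 1) => 2 ≤ (i : ℕ)), X i ^ 2) :
        MvPolynomial (Fin (n + 1)) K) n ≤ 2 * n * (n - 2) := by
  obtain ⟨a, rfl⟩ := Nat.exists_eq_add_of_le' (show 3 ≤ n by omega)
  have hF : ((X 0) ^ (a + 3 - 3) * X 1 *
        (∑ i ∈ Finset.univ.filter (fun i : Fin (a + 3 + 1) => 2 ≤ (i : ℕ)), X i ^ 2) :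
        MvPolynomial (Fin (a + 3 + 1)) K) = quadricCone K a := by
    rw [quadricCone, ← Finset.mul_sum, Finset.sum_filter, Fin.sum_univ_succ, Fin.sum_univ_succ]
    simp
  rw [hF]
  have hup : IsWaringDecomp (quadricCone K a) (a + 3) (2 * (a + 3) * (a + 3 - 2)) :=
    isWaringDecomp_quadricCone (by omega) (by
      rw [show a + 3 - 2 = a + 1 by omega]
      nlinarith)
  have hmin : IsWaringDecomp (quadricCone K a) (a + 3) (waringRank (quadricCone K a) (a + 3)) :=
    Nat.sInf_mem (s := {r | IsWaringDecomp (quadricCone K a) (a + 3) r}) ⟨_, hup⟩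
  exact ⟨le_of_isWaringDecomp_quadricCone (by omega) hmin, Nat.sInf_le hup⟩
end
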